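/- arXiv:1707.02888 — 2 statements merged into one kernel-verified Lean document; each statement's English description precedes it below -/
import Mathlib

section
/- (Classification, Chen–Li / Liouville) Let K > 0 and let u be a C² solution of -Δu = K e^u on ℝ² with u(0) = 0, ∇u(0) = 0, and ∫_{ℝ²} e^u dx < ∞. Then u(x) = -2 log(1 + γ|x|²) where γ = K/8. -/
open MeasureTheory Real

/-- The Euclidean Laplacian `Δu = ∑ ∂²u/∂xᵢ²`. -/
noncomputable def lap {n : ℕ} (u : EuclideanSpace ℝ (Fin n) → ℝ)
    (x : EuclideanSpace ℝ (Fin n)) : ℝ :=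
  ∑ i : Fin n, iteratedFDeriv ℝ 2 u x ![EuclideanSpace.single i 1, EuclideanSpace.single i 1]

/-- The Euclidean plane. -/
abbrev Plane := EuclideanSpace ℝ (Fin 2)

/-- The partial derivative `∂f/∂xᵢ` on the plane. -/
noncomputable def pd (i : Fin 2) (f : Plane → ℝ) (x : Plane) : ℝ :=
  fderiv ℝ f x (EuclideanSpace.single i 1)

theorem pd_contDiff {i : Fin 2} {f : Plane → ℝ} {m n : WithTop ℕ∞} (hf : ContDiff ℝ n f)
    (hmn : m + 1 ≤ n) : ContDiff ℝ m (pd i f) :=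
  (hf.fderiv_right hmn).clm_apply contDiff_const

theorem pd_contDiff_one {i : Fin 2} {f : Plane → ℝ} (hf : ContDiff ℝ 2 f) :
    ContDiff ℝ 1 (pd i f) :=
  pd_contDiff hf (by norm_num)

theorem pd_continuous {i : Fin 2} {f : Plane → ℝ} (hf : ContDiff ℝ 1 f) :
    Continuous (pd i f) :=
  (pd_contDiff (m := 0) hf (by norm_num)).continuous

theorem pd_pd_continuous {i j : Fin 2} {f : Plane → ℝ} (hf : ContDiff ℝ 2 f) :
    Continuous (pd i (pd j f)) :=
  pd_continuous (pd_contDiff_one hf)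

theorem pd_pd_eq_iteratedFDeriv {i j : Fin 2} {f : Plane → ℝ} (hf : ContDiff ℝ 2 f) (x : Plane) :
    pd i (pd j f) x =
      iteratedFDeriv ℝ 2 f x ![EuclideanSpace.single i 1, EuclideanSpace.single j 1] := by
  have h : DifferentiableAt ℝ (fderiv ℝ f) x :=
    (hf.fderiv_right (m := 1) (by norm_num)).differentiable (by norm_num) x
  rw [iteratedFDeriv_two_apply]
  unfold pd
  rw [fderiv_clm_apply h (differentiableAt_const _)]
  simp

theorem pd_comm {i j : Fin 2} {f : Plane → ℝ} (hf : ContDiff ℝ 2 f) :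
    pd i (pd j f) = pd j (pd i f) := by
  ext x
  have h : IsSymmSndFDerivAt ℝ f x :=
    hf.contDiffAt.isSymmSndFDerivAt (by simp)
  rw [pd_pd_eq_iteratedFDeriv hf, pd_pd_eq_iteratedFDeriv hf, iteratedFDeriv_two_apply,
    iteratedFDeriv_two_apply]
  simpa using h _ _

theorem pd_sub {i : Fin 2} {f g : Plane → ℝ} {x : Plane} (hf : DifferentiableAt ℝ f x)
    (hg : DifferentiableAt ℝ g x) : pd i (fun y => f y - g y) x = pd i f x - pd i g x := by
  unfold pd
  rw [fderiv_fun_sub hf hg]; rfl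

theorem pd_mul {i : Fin 2} {f g : Plane → ℝ} {x : Plane} (hf : DifferentiableAt ℝ f x)
    (hg : DifferentiableAt ℝ g x) :
    pd i (fun y => f y * g y) x = f x * pd i g x + pd i f x * g x := by
  unfold pd
  rw [fderiv_fun_mul hf hg]
  simp [mul_comm]

theorem pd_const_mul {i : Fin 2} {f : Plane → ℝ} {x : Plane} (c : ℝ)
    (hf : DifferentiableAt ℝ f x) : pd i (fun y => c * f y) x = c * pd i f x := by
  unfold pd
  rw [fderiv_const_mul hf]; rfl

theorem pd_exp {i : Fin 2} {f : Plane → ℝ} {x : Plane} (hf : DifferentiableAt ℝ f x) :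
    pd i (fun y => Real.exp (f y)) x = Real.exp (f x) * pd i f x := by
  unfold pd
  rw [hf.hasFDerivAt.exp.fderiv]; rfl

theorem pd_coord {i j : Fin 2} {x : Plane} :
    pd i (fun y : Plane => y j) x = if i = j then 1 else 0 := by
  unfold pd
  have h : HasFDerivAt (fun y : Plane => y j) (EuclideanSpace.proj j : Plane →L[ℝ] ℝ) x :=
    (EuclideanSpace.proj j : Plane →L[ℝ] ℝ).hasFDerivAt
  rw [h.fderiv]
  simp [eq_comm]

theorem pd_comp_affine {i : Fin 2} {f : Plane → ℝ} (x₀ : Plane) (r : ℝ) (hf : Differentiable ℝ f) :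
    pd i (fun y => f (x₀ + r • y)) = fun y => r * pd i f (x₀ + r • y) := by
  ext y
  have h : HasFDerivAt (fun y : Plane => x₀ + r • y) (r • ContinuousLinearMap.id ℝ Plane) y :=
    ((hasFDerivAt_id y).const_smul r).const_add x₀
  unfold pd
  have h2 := (hf (x₀ + r • y)).hasFDerivAt.comp y h
  rw [show (fun y => f (x₀ + r • y)) = f ∘ (fun y => x₀ + r • y) from rfl, h2.fderiv]
  simp

theorem contDiff_comp_affine {n : WithTop ℕ∞} {f : Plane → ℝ} (x₀ : Plane) (r : ℝ)
    (hf : ContDiff ℝ n f) : ContDiff ℝ n (fun y => f (x₀ + r • y)) := by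
  fun_prop

theorem pd_pd_comp_affine {i j : Fin 2} {f : Plane → ℝ} (x₀ : Plane) (r : ℝ)
    (hf : ContDiff ℝ 2 f) :
    pd i (pd j (fun y => f (x₀ + r • y))) = fun y => r ^ 2 * pd i (pd j f) (x₀ + r • y) := by
  have h1 := (pd_contDiff_one (i := j) hf).differentiable (by norm_num)
  rw [pd_comp_affine x₀ r (hf.differentiable (by norm_num))]
  ext y
  rw [pd_const_mul]
  · rw [pd_comp_affine x₀ r h1]; ring
  · have := contDiff_comp_affine x₀ r (pd_contDiff_one (i := j) hf)
    exact this.differentiable (by norm_num) y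

theorem pd_hasCompactSupport {i : Fin 2} {f : Plane → ℝ} (hf : HasCompactSupport f) :
    HasCompactSupport (pd i f) :=
  (hf.fderiv (𝕜 := ℝ)).comp_left
    (g := fun l : Plane →L[ℝ] ℝ => l (EuclideanSpace.single i 1)) rfl

theorem fderiv_apply_eq_sum_pd {f : Plane → ℝ} (x v : Plane) :
    fderiv ℝ f x v = pd 0 f x * v 0 + pd 1 f x * v 1 := by
  have hv : v = v 0 • EuclideanSpace.single 0 (1 : ℝ) + v 1 • EuclideanSpace.single 1 (1 : ℝ) := by
    ext i; fin_cases i <;> simp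
  conv_lhs => rw [hv]
  rw [map_add, map_smul, map_smul]
  simp [pd, mul_comm]

theorem lap_eq_pd {f : Plane → ℝ} (hf : ContDiff ℝ 2 f) (x : Plane) :
    lap f x = pd 0 (pd 0 f) x + pd 1 (pd 1 f) x := by
  simp [lap, Fin.sum_univ_two, pd_pd_eq_iteratedFDeriv hf]

/-- Integration by parts against a compactly supported function. -/
theorem integral_pd_mul {i : Fin 2} {f g : Plane → ℝ} (hf : ContDiff ℝ 1 f) (hg : ContDiff ℝ 1 g)
    (hc : HasCompactSupport g) :
    ∫ x, pd i f x * g x = -∫ x, f x * pd i g x := by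
  have hc' := pd_hasCompactSupport (i := i) hc
  have h1 : Integrable (fun x => pd i f x * g x) :=
    ((pd_continuous hf).mul hg.continuous).integrable_of_hasCompactSupport hc.mul_left
  have h2 : Integrable (fun x => f x * pd i g x) :=
    (hf.continuous.mul (pd_continuous hg)).integrable_of_hasCompactSupport hc'.mul_left
  have h3 : Integrable (fun x => f x * g x) :=
    (hf.continuous.mul hg.continuous).integrable_of_hasCompactSupport hc.mul_left
  have := integral_mul_fderiv_eq_neg_fderiv_mul_of_integrable (𝕜 := ℝ) (μ := volume)
    (v := EuclideanSpace.single i 1) (f := f) (g := g) h1 h2 h3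
    (fun x _ => hf.differentiable (by norm_num) x) (fun x _ => hg.differentiable (by norm_num) x)
  unfold pd
  rw [this, neg_neg]

theorem integral_pd_pd_mul {i j : Fin 2} {f g : Plane → ℝ} (hf : ContDiff ℝ 2 f)
    (hg : ContDiff ℝ 2 g) (hc : HasCompactSupport g) :
    ∫ x, pd i (pd j f) x * g x = ∫ x, f x * pd j (pd i g) x := by
  rw [integral_pd_mul (pd_contDiff_one hf) (hg.of_le (by norm_num)) hc,
    integral_pd_mul (hf.of_le (by norm_num)) (pd_contDiff_one hg) (pd_hasCompactSupport hc),
    neg_neg]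

/-- Differentiation under the integral sign for a family with locally uniform compact support. -/
theorem hasDerivAt_integral_of_compact {F F' : ℝ → Plane → ℝ} {r₀ ε : ℝ} (hε : 0 < ε)
    {S : Set Plane} (hS : IsCompact S) (hF : ∀ r, Continuous (F r))
    (hF' : Continuous (Function.uncurry F'))
    (hFS : ∀ y ∉ S, F r₀ y = 0)
    (hFS' : ∀ r ∈ Metric.ball r₀ ε, ∀ y ∉ S, F' r y = 0)
    (hd : ∀ r y, HasDerivAt (fun s => F s y) (F' r y) r) :
    HasDerivAt (fun r => ∫ y, F r y) (∫ y, F' r₀ y) r₀ := by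
  obtain ⟨C, hC⟩ := ((isCompact_closedBall r₀ ε).prod hS).exists_bound_of_continuousOn
    hF'.continuousOn
  refine (hasDerivAt_integral_of_dominated_loc_of_deriv_le (μ := volume)
    (bound := S.indicator fun _ => C) (Metric.ball_mem_nhds r₀ hε)
    (Filter.Eventually.of_forall fun r => (hF r).aestronglyMeasurable) ?_ ?_ ?_ ?_ ?_).2
  · exact (hF r₀).integrable_of_hasCompactSupport (HasCompactSupport.intro hS hFS)
  · exact (hF'.comp (Continuous.prodMk_right r₀)).aestronglyMeasurable
  · refine Filter.Eventually.of_forall fun y r hr => ?_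
    by_cases hy : y ∈ S
    · rw [Set.indicator_of_mem hy]
      exact hC (r, y) ⟨Metric.ball_subset_closedBall hr, hy⟩
    · simp [hy, hFS' r hr y hy]
  · exact (integrable_indicator_iff hS.measurableSet).2
      (integrableOn_const hS.measure_lt_top.ne)
  · exact Filter.Eventually.of_forall fun y r _ => hd r y

/-- A smooth cutoff profile: `1` on `t ≤ 1` and `0` on `4 ≤ t`. -/
noncomputable def cutoffProfile (t : ℝ) : ℝ := Real.smoothTransition ((4 - t) / 3)

theorem cutoffProfile_contDiff {n : ℕ∞} : ContDiff ℝ n cutoffProfile :=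
  Real.smoothTransition.contDiff.comp (by fun_prop)

theorem cutoffProfile_eq_zero {t : ℝ} (ht : 4 ≤ t) : cutoffProfile t = 0 :=
  Real.smoothTransition.zero_of_nonpos (by linarith)

theorem cutoffProfile_eq_one {t : ℝ} (ht : t ≤ 1) : cutoffProfile t = 1 :=
  Real.smoothTransition.one_of_one_le (by linarith)

/-- A smooth radial cutoff: `1` on the unit ball and `0` off the ball of radius `2`. -/
noncomputable def cutoff (y : Plane) : ℝ := cutoffProfile (‖y‖ ^ 2)

/-- A radial potential with `∇ cutoffPotential y = -cutoff y • y`. -/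
noncomputable def cutoffPotential (y : Plane) : ℝ :=
  ∫ t in (‖y‖ ^ 2)..4, cutoffProfile t / 2

theorem cutoff_nonneg (y : Plane) : 0 ≤ cutoff y := Real.smoothTransition.nonneg _

theorem cutoff_le_one (y : Plane) : cutoff y ≤ 1 := Real.smoothTransition.le_one _

theorem cutoff_eq_one {y : Plane} (hy : ‖y‖ ≤ 1) : cutoff y = 1 :=
  cutoffProfile_eq_one (by nlinarith [norm_nonneg y])

theorem cutoff_eq_zero {y : Plane} (hy : y ∉ Metric.closedBall (0 : Plane) 2) : cutoff y = 0 := by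
  rw [mem_closedBall_zero_iff, not_le] at hy
  exact cutoffProfile_eq_zero (by nlinarith)

theorem cutoff_contDiff {n : ℕ∞} : ContDiff ℝ n cutoff :=
  cutoffProfile_contDiff.comp (contDiff_norm_sq ℝ)

theorem cutoff_hasCompactSupport : HasCompactSupport cutoff :=
  HasCompactSupport.intro (isCompact_closedBall 0 2) fun _ => cutoff_eq_zero

theorem integral_cutoff_pos : 0 < ∫ y, cutoff y := by
  have hc : Continuous cutoff := (cutoff_contDiff (n := 0)).continuous
  refine hc.integral_pos_of_hasCompactSupport_nonneg_nonzero cutoff_hasCompactSupport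
    cutoff_nonneg (x := 0) ?_
  rw [cutoff_eq_one (by simp)]
  norm_num

theorem pd_comp_norm_sq {i : Fin 2} {g : ℝ → ℝ} {g' : ℝ} {y : Plane}
    (hg : HasDerivAt g g' (‖y‖ ^ 2)) :
    pd i (fun z => g (‖z‖ ^ 2)) y = 2 * g' * y i := by
  have h := hg.comp_hasFDerivAt y (hasStrictFDerivAt_norm_sq y).hasFDerivAt
  unfold pd
  rw [show (fun z : Plane => g (‖z‖ ^ 2)) = g ∘ fun z => ‖z‖ ^ 2 from rfl, h.fderiv]
  simp [EuclideanSpace.inner_single_right]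
  ring

theorem cutoff_radial (y : Plane) : y 0 * pd 1 cutoff y = y 1 * pd 0 cutoff y := by
  have h : HasDerivAt cutoffProfile (deriv cutoffProfile (‖y‖ ^ 2)) (‖y‖ ^ 2) :=
    ((cutoffProfile_contDiff (n := 1)).differentiable (by norm_num) _).hasDerivAt
  have e (i : Fin 2) : pd i cutoff y = 2 * deriv cutoffProfile (‖y‖ ^ 2) * y i :=
    pd_comp_norm_sq h
  rw [e, e]
  ring

theorem hasDerivAt_integral_cutoffProfile (s : ℝ) :
    HasDerivAt (fun s => ∫ t in s..4, cutoffProfile t / 2) (-(cutoffProfile s / 2)) s := by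
  have hc : Continuous fun t => cutoffProfile t / 2 :=
    (cutoffProfile_contDiff (n := 0)).continuous.div_const 2
  exact intervalIntegral.integral_hasDerivAt_left (hc.intervalIntegrable _ _)
    (hc.stronglyMeasurableAtFilter _ _) hc.continuousAt

theorem cutoffPotential_contDiff : ContDiff ℝ 1 cutoffPotential := by
  have h : ContDiff ℝ 1 (fun s => ∫ t in s..4, cutoffProfile t / 2) := by
    refine contDiff_one_iff_deriv.2
      ⟨fun s => (hasDerivAt_integral_cutoffProfile s).differentiableAt, ?_⟩
    rw [show deriv (fun s => ∫ t in s..4, cutoffProfile t / 2) = fun s => -(cutoffProfile s / 2)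
      from funext fun s => (hasDerivAt_integral_cutoffProfile s).deriv]
    exact ((cutoffProfile_contDiff (n := 0)).continuous.div_const 2).neg
  exact h.comp (contDiff_norm_sq ℝ)

theorem pd_cutoffPotential {i : Fin 2} (y : Plane) :
    pd i cutoffPotential y = -(y i * cutoff y) := by
  rw [show cutoffPotential = fun y : Plane => (fun s => ∫ t in s..4, cutoffProfile t / 2) (‖y‖ ^ 2)
    from rfl, pd_comp_norm_sq (hasDerivAt_integral_cutoffProfile _)]
  unfold cutoff
  ring

theorem cutoffPotential_eq_zero {y : Plane} (hy : y ∉ Metric.closedBall (0 : Plane) 2) :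
    cutoffPotential y = 0 := by
  rw [mem_closedBall_zero_iff, not_le] at hy
  have h4 : 4 ≤ ‖y‖ ^ 2 := by nlinarith
  unfold cutoffPotential
  rw [intervalIntegral.integral_symm, intervalIntegral.integral_congr (g := fun _ => 0)]
  · simp
  · intro t ht
    rw [Set.uIcc_of_le h4] at ht
    simp [cutoffProfile_eq_zero ht.1]

theorem cutoffPotential_nonneg (y : Plane) : 0 ≤ cutoffPotential y := by
  by_cases hy : y ∈ Metric.closedBall (0 : Plane) 2
  · rw [mem_closedBall_zero_iff] at hy
    exact intervalIntegral.integral_nonneg (by nlinarith [norm_nonneg y])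
      fun t _ => div_nonneg (Real.smoothTransition.nonneg _) zero_le_two
  · rw [cutoffPotential_eq_zero hy]

theorem cutoffPotential_hasCompactSupport : HasCompactSupport cutoffPotential :=
  HasCompactSupport.intro (isCompact_closedBall 0 2) fun _ => cutoffPotential_eq_zero

theorem cutoffPotential_le_two (y : Plane) : cutoffPotential y ≤ 2 := by
  by_cases hy : y ∈ Metric.closedBall (0 : Plane) 2
  · rw [mem_closedBall_zero_iff] at hy
    have h4 : ‖y‖ ^ 2 ≤ 4 := by nlinarith [norm_nonneg y]
    have hc : Continuous fun t => cutoffProfile t / 2 :=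
      (cutoffProfile_contDiff (n := 0)).continuous.div_const 2
    calc cutoffPotential y ≤ ∫ _ in (‖y‖ ^ 2)..4, (1 / 2 : ℝ) :=
          intervalIntegral.integral_mono_on h4 (hc.intervalIntegrable _ _) (by simp)
            fun t _ => by
              have := Real.smoothTransition.le_one ((4 - t) / 3)
              unfold cutoffProfile; linarith
      _ ≤ 2 := by
          rw [intervalIntegral.integral_const, smul_eq_mul]
          nlinarith [sq_nonneg ‖y‖]
  · rw [cutoffPotential_eq_zero hy]
    norm_num

/-- The derivative in `r` of the weighted mean of `f` at scale `r`. -/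
theorem hasDerivAt_weighted_mean {f : Plane → ℝ} (hf : ContDiff ℝ 2 f) (x₀ : Plane) (r : ℝ) :
    HasDerivAt (fun r => ∫ y, f (x₀ + r • y) * cutoff y)
      (r * ∫ y, (pd 0 (pd 0 f) (x₀ + r • y) + pd 1 (pd 1 f) (x₀ + r • y)) * cutoffPotential y)
      r := by
  have hk : Continuous cutoff := (cutoff_contDiff (n := 0)).continuous
  have hp (i : Fin 2) : Continuous (pd i f) := pd_continuous (hf.of_le (by norm_num))
  have hcoord (i : Fin 2) : Continuous fun y : Plane => y i := by fun_prop
  have key := hasDerivAt_integral_of_compact (r₀ := r)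
    (F := fun r y => f (x₀ + r • y) * cutoff y)
    (F' := fun r y => (pd 0 f (x₀ + r • y) * y 0 + pd 1 f (x₀ + r • y) * y 1) * cutoff y)
    one_pos (isCompact_closedBall (0 : Plane) 2) (fun r => ?_) ?_ ?_ ?_ ?_
  · convert key using 1
    have ibp (i : Fin 2) : ∫ y, pd i f (x₀ + r • y) * y i * cutoff y
        = r * ∫ y, pd i (pd i f) (x₀ + r • y) * cutoffPotential y := by
      have h := integral_pd_mul (i := i) (contDiff_comp_affine x₀ r (pd_contDiff_one (i := i) hf))
        cutoffPotential_contDiff cutoffPotential_hasCompactSupport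
      rw [pd_comp_affine x₀ r ((pd_contDiff_one hf).differentiable (by norm_num))] at h
      simp only [pd_cutoffPotential, mul_neg, integral_neg, neg_neg, mul_assoc] at h
      rw [integral_const_mul] at h
      rw [h]
      simp only [mul_assoc]
    have int1 (i : Fin 2) : Integrable fun y => pd i f (x₀ + r • y) * y i * cutoff y := by
      refine Continuous.integrable_of_hasCompactSupport ?_ cutoff_hasCompactSupport.mul_left
      have := hp i
      fun_prop
    have int2 (i : Fin 2) : Integrable fun y =>
        pd i (pd i f) (x₀ + r • y) * cutoffPotential y := by
      refine Continuous.integrable_of_hasCompactSupport ?_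
        cutoffPotential_hasCompactSupport.mul_left
      have := pd_pd_continuous (i := i) (j := i) hf
      have := cutoffPotential_contDiff.continuous
      fun_prop
    simp only [add_mul]
    rw [integral_add (int1 0) (int1 1), integral_add (int2 0) (int2 1), ibp, ibp, mul_add]
  · have := hf.continuous
    fun_prop
  · have := hp 0
    have := hp 1
    simp only [Function.uncurry_def]
    fun_prop
  · intro y hy
    simp [cutoff_eq_zero hy]
  · intro s _ y hy
    simp [cutoff_eq_zero hy]
  · intro s y
    have h1 : HasDerivAt (fun s : ℝ => x₀ + s • y) y s := by
      simpa using ((hasDerivAt_id s).smul_const y).const_add x₀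
    have h2 := ((hf.differentiable (by norm_num)) (x₀ + s • y)).hasFDerivAt.comp_hasDerivAt s h1
    rw [fderiv_apply_eq_sum_pd] at h2
    exact h2.mul_const _

theorem integral_comp_affine (h : Plane → ℝ) (x₀ : Plane) (r : ℝ) :
    ∫ y, h (x₀ + r • y) = (r ^ 2)⁻¹ * ∫ z, h z := by
  rw [Measure.integral_comp_smul volume (fun z => h (x₀ + z)) r,
    integral_add_left_eq_self (μ := volume) h x₀]
  simp [abs_of_nonneg (sq_nonneg r)]

theorem integrable_comp_affine {h : Plane → ℝ} (hi : Integrable h) (x₀ : Plane) {r : ℝ}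
    (hr : r ≠ 0) : Integrable fun y => h (x₀ + r • y) :=
  (hi.comp_add_left x₀).comp_smul hr

theorem mean_value_ineq {f : Plane → ℝ} (hf : ContDiff ℝ 2 f) {x₀ : Plane} {r B : ℝ} (hr : 0 ≤ r)
    (hB : ∀ z ∈ Metric.closedBall x₀ (2 * r), -B ≤ pd 0 (pd 0 f) z + pd 1 (pd 1 f) z) :
    (∫ y, cutoff y) * f x₀ ≤
      (∫ y, f (x₀ + r • y) * cutoff y) + (∫ y, cutoffPotential y) / 2 * B * r ^ 2 := by
  set m : ℝ → ℝ := fun t =>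
    (∫ y, f (x₀ + t • y) * cutoff y) + (∫ y, cutoffPotential y) / 2 * B * t ^ 2
  have hm (t : ℝ) := (hasDerivAt_weighted_mean hf x₀ t).add
    ((hasDerivAt_pow 2 t).const_mul ((∫ y, cutoffPotential y) / 2 * B))
  have hmono : MonotoneOn m (Set.Icc 0 r) := by
    refine monotoneOn_of_deriv_nonneg (convex_Icc 0 r)
      (fun t _ => (hm t).continuousAt.continuousWithinAt)
      (fun t _ => (hm t).differentiableAt.differentiableWithinAt) fun t ht => ?_
    rw [interior_Icc] at ht
    refine le_of_le_of_eq ?_ (hm t).deriv.symm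
    have hΨ : Continuous cutoffPotential := cutoffPotential_contDiff.continuous
    have h0 := pd_pd_continuous (i := 0) (j := 0) hf
    have h1 := pd_pd_continuous (i := 1) (j := 1) hf
    have i1 : Integrable fun y => (pd 0 (pd 0 f) (x₀ + t • y) + pd 1 (pd 1 f) (x₀ + t • y)) *
        cutoffPotential y :=
      Continuous.integrable_of_hasCompactSupport (by fun_prop)
        cutoffPotential_hasCompactSupport.mul_left
    have i2 : Integrable fun y => B * cutoffPotential y :=
      (hΨ.integrable_of_hasCompactSupport cutoffPotential_hasCompactSupport).const_mul B
    have hpos : 0 ≤ (∫ y, (pd 0 (pd 0 f) (x₀ + t • y) + pd 1 (pd 1 f) (x₀ + t • y)) *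
        cutoffPotential y) + B * ∫ y, cutoffPotential y := by
      rw [← integral_const_mul, ← integral_add i1 i2]
      refine integral_nonneg fun y => ?_
      by_cases hy : y ∈ Metric.closedBall (0 : Plane) 2
      · have hz : x₀ + t • y ∈ Metric.closedBall x₀ (2 * r) := by
          rw [mem_closedBall_zero_iff] at hy
          simp only [mem_closedBall_iff_norm, add_sub_cancel_left, norm_smul, Real.norm_eq_abs,
            abs_of_pos ht.1]
          nlinarith [ht.1, ht.2, norm_nonneg y]
        have := mul_nonneg (by linarith [hB _ hz] : 0 ≤ pd 0 (pd 0 f) (x₀ + t • y) +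
          pd 1 (pd 1 f) (x₀ + t • y) + B) (cutoffPotential_nonneg y)
        simp only [Pi.zero_apply]
        linarith
      · simp [cutoffPotential_eq_zero hy]
    have := mul_nonneg ht.1.le hpos
    simp only [Nat.cast_ofNat, Nat.add_one_sub_one, pow_one]
    linarith
  have h := hmono (Set.left_mem_Icc.2 hr) (Set.right_mem_Icc.2 hr) hr
  simp only [m, zero_smul, add_zero, integral_const_mul] at h
  linarith

theorem laplacian_exp_ge {K : ℝ} {u : Plane → ℝ} (hu : ContDiff ℝ 2 u)
    (heq : ∀ x, pd 0 (pd 0 u) x + pd 1 (pd 1 u) x = -(K * Real.exp (u x))) (x : Plane) :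
    -(K * Real.exp (u x) ^ 2) ≤
      pd 0 (pd 0 fun y => Real.exp (u y)) x + pd 1 (pd 1 fun y => Real.exp (u y)) x := by
  have hd : Differentiable ℝ u := hu.differentiable (by norm_num)
  have e (i : Fin 2) : pd i (pd i fun y => Real.exp (u y)) x =
      Real.exp (u x) * pd i (pd i u) x + Real.exp (u x) * pd i u x ^ 2 := by
    rw [show pd i (fun y => Real.exp (u y)) = fun y => Real.exp (u y) * pd i u y from
      funext fun y => pd_exp (hd y), pd_mul (hd x).exp
        ((pd_contDiff_one hu).differentiable (by norm_num) x), pd_exp (hd x)]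
    ring
  rw [e, e]
  have h1 : 0 ≤ Real.exp (u x) * (pd 0 u x ^ 2 + pd 1 u x ^ 2) := by positivity
  have h2 : Real.exp (u x) * (pd 0 (pd 0 u) x + pd 1 (pd 1 u) x) = -(K * Real.exp (u x) ^ 2) := by
    rw [heq]; ring
  linarith

theorem integral_comp_affine_mul_cutoff_le {ρ : Plane → ℝ} (hρ : ∀ x, 0 ≤ ρ x)
    (hi : Integrable ρ) (hc : Continuous ρ) (x₀ : Plane) {r : ℝ} (hr : 0 < r) {S : Set Plane}
    (hS : MeasurableSet S) (hsub : Metric.closedBall x₀ (2 * r) ⊆ S) :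
    ∫ y, ρ (x₀ + r • y) * cutoff y ≤ (r ^ 2)⁻¹ * ∫ z in S, ρ z := by
  rw [← integral_indicator hS, ← integral_comp_affine]
  have hk : Continuous cutoff := (cutoff_contDiff (n := 0)).continuous
  refine integral_mono ?_ (integrable_comp_affine (hi.indicator hS) x₀ hr.ne') fun y => ?_
  · exact Continuous.integrable_of_hasCompactSupport (by fun_prop)
      cutoff_hasCompactSupport.mul_left
  · by_cases hy : y ∈ Metric.closedBall (0 : Plane) 2
    · have hz : x₀ + r • y ∈ Metric.closedBall x₀ (2 * r) := by
        rw [mem_closedBall_zero_iff] at hy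
        simp only [mem_closedBall_iff_norm, add_sub_cancel_left, norm_smul, Real.norm_eq_abs,
          abs_of_pos hr]
        nlinarith [norm_nonneg y]
      simp only [Set.indicator_of_mem (hsub hz)]
      exact mul_le_of_le_one_right (hρ _) (cutoff_le_one y)
    · simp only [cutoff_eq_zero hy, mul_zero]
      exact Set.indicator_nonneg (fun z _ => hρ z) _

/-- A Heinz-type `ε`-regularity estimate for `Δρ ≥ -K ρ²`. -/
theorem exists_pointwise_bound_of_small_integral {K : ℝ} (hK : 0 < K) :
    ∃ ε > 0, ∃ C : ℝ, ∀ ρ : Plane → ℝ, ContDiff ℝ 2 ρ → (∀ x, 0 ≤ ρ x) → Integrable ρ →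
      (∀ x, -(K * ρ x ^ 2) ≤ pd 0 (pd 0 ρ) x + pd 1 (pd 1 ρ) x) →
      ∀ x₀, ∫ z in Metric.closedBall x₀ 1, ρ z ≤ ε → ρ x₀ ≤ C := by
  obtain ⟨c₀, hc₀⟩ : ∃ c₀, c₀ = ∫ y, cutoff y := ⟨_, rfl⟩
  obtain ⟨D, hD⟩ : ∃ D, D = (∫ y, cutoffPotential y) / 2 + 1 := ⟨_, rfl⟩
  have hc₀pos : 0 < c₀ := hc₀ ▸ integral_cutoff_pos
  have hDpos : 0 < D := by
    have : 0 ≤ ∫ y, cutoffPotential y := integral_nonneg cutoffPotential_nonneg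
    rw [hD]; linarith
  refine ⟨c₀ ^ 2 / (128 * D * K), by positivity, c₀ / (2 * D * K), ?_⟩
  intro ρ hρ hρ0 hρi hρΔ x₀ hx₀
  obtain ⟨x₁, hx₁, hmax⟩ := (isCompact_closedBall x₀ (1 : ℝ)).exists_isMaxOn
    ⟨x₀, Metric.mem_closedBall_self zero_le_one⟩
    (f := fun x => (1 - dist x x₀) ^ 2 * ρ x) (by have := hρ.continuous; fun_prop)
  rw [isMaxOn_iff] at hmax
  obtain ⟨d, hd⟩ : ∃ d, d = 1 - dist x₁ x₀ := ⟨_, rfl⟩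
  obtain ⟨c, hc⟩ : ∃ c, c = ρ x₁ := ⟨_, rfl⟩
  rw [Metric.mem_closedBall] at hx₁
  have hd0 : 0 ≤ d := by linarith
  have hc0 : 0 ≤ c := hc ▸ hρ0 x₁
  rw [← hd, ← hc] at hmax
  have hx₀' : ρ x₀ ≤ d ^ 2 * c := by
    simpa using hmax x₀ (Metric.mem_closedBall_self zero_le_one)
  refine hx₀'.trans (le_of_not_gt fun hlt => ?_)
  rw [div_lt_iff₀ (by positivity)] at hlt
  have hcpos : 0 < c := by
    rcases hc0.eq_or_lt with h | h
    · rw [← h] at hlt; linarith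
    · exact h
  have hdpos : 0 < d := by
    rcases hd0.eq_or_lt with h | h
    · rw [← h] at hlt; linarith
    · exact h
  obtain ⟨r, hr⟩ : ∃ r, r = Real.sqrt (c₀ / (32 * D * K * c)) := ⟨_, rfl⟩
  have hrpos : 0 < r := hr ▸ Real.sqrt_pos.2 (by positivity)
  have hr2 : r ^ 2 = c₀ / (32 * D * K * c) := hr ▸ Real.sq_sqrt (by positivity)
  have hr2' : r ^ 2 * (32 * D * K * c) = c₀ := by rw [hr2]; field_simp
  have hrd : 4 * r ≤ d := by
    refine (sq_le_sq₀ (by positivity) hd0).1 ?_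
    have : (4 * r) ^ 2 * (2 * D * K * c) ≤ d ^ 2 * (2 * D * K * c) := by nlinarith
    exact le_of_mul_le_mul_right this (by positivity)
  have hball : Metric.closedBall x₁ (2 * r) ⊆ Metric.closedBall x₀ 1 :=
    Metric.closedBall_subset_closedBall' (by linarith)
  have hmv := mean_value_ineq hρ (x₀ := x₁) (r := r) (B := K * (4 * c) ^ 2) hrpos.le
    (fun z hz => by
      have h1 : dist z x₀ ≤ 1 - d / 2 := by
        have := dist_triangle z x₁ x₀
        rw [Metric.mem_closedBall] at hz
        linarith
      have h2 := hmax z (hball hz)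
      have h3 : (d / 2) ^ 2 * ρ z ≤ (1 - dist z x₀) ^ 2 * ρ z :=
        mul_le_mul_of_nonneg_right (pow_le_pow_left₀ (by positivity) (by linarith) 2) (hρ0 z)
      have h4 : ρ z ≤ 4 * c := by
        refine le_of_mul_le_mul_left (a := d ^ 2) ?_ (by positivity)
        linarith
      have h5 : K * ρ z ^ 2 ≤ K * (4 * c) ^ 2 :=
        mul_le_mul_of_nonneg_left (pow_le_pow_left₀ (hρ0 z) h4 2) hK.le
      linarith [hρΔ z])
  have hint := integral_comp_affine_mul_cutoff_le hρ0 hρi hρ.continuous x₁ hrpos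
    Metric.isClosed_closedBall.measurableSet hball
  rw [← hc₀, ← hc] at hmv
  have h6 : (∫ y, cutoffPotential y) / 2 * (K * (4 * c) ^ 2) * r ^ 2 ≤ c₀ * c / 2 := by
    have : (∫ y, cutoffPotential y) / 2 * (K * (4 * c) ^ 2 * r ^ 2)
        ≤ D * (K * (4 * c) ^ 2 * r ^ 2) :=
      mul_le_mul_of_nonneg_right (by linarith) (by positivity)
    calc _ ≤ D * (K * (4 * c) ^ 2 * r ^ 2) := by linarith
      _ = r ^ 2 * (32 * D * K * c) * c / 2 := by ring
      _ = c₀ * c / 2 := by rw [hr2']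
  have h7 : (r ^ 2)⁻¹ * ∫ z in Metric.closedBall x₀ 1, ρ z ≤ c₀ * c / 4 := by
    calc _ ≤ (r ^ 2)⁻¹ * (c₀ ^ 2 / (128 * D * K)) := by gcongr
      _ = c₀ * c / 4 := by rw [hr2]; field_simp; norm_num
  have : 0 < c₀ * c := by positivity
  linarith

theorem exists_upper_bound {K : ℝ} (hK : 0 < K) {u : Plane → ℝ} (hu : ContDiff ℝ 2 u)
    (heq : ∀ x, pd 0 (pd 0 u) x + pd 1 (pd 1 u) x = -(K * Real.exp (u x)))
    (hint : Integrable fun x => Real.exp (u x)) : ∃ M, ∀ x, u x ≤ M := by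
  obtain ⟨ε, hε, C, hC⟩ := exists_pointwise_bound_of_small_integral hK
  have htail : Filter.Tendsto
      (fun n : ℕ => ∫ x in (Metric.closedBall (0 : Plane) n)ᶜ, Real.exp (u x))
      Filter.atTop (nhds 0) := by
    have h := tendsto_setIntegral_of_antitone (μ := volume) (f := fun x => Real.exp (u x))
      (s := fun n : ℕ => (Metric.closedBall (0 : Plane) n)ᶜ)
      (fun n => Metric.isClosed_closedBall.measurableSet.compl)
      (fun m n hmn => Set.compl_subset_compl.2
        (Metric.closedBall_subset_closedBall (by exact_mod_cast hmn)))
      ⟨0, hint.integrableOn⟩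
    rwa [← Set.compl_iUnion, Metric.iUnion_closedBall_nat, Set.compl_univ,
      setIntegral_empty] at h
  obtain ⟨n, hn⟩ := (htail.eventually (gt_mem_nhds hε)).exists
  obtain ⟨M₀, hM₀⟩ := (isCompact_closedBall (0 : Plane) (n + 1)).exists_bound_of_continuousOn
    hu.continuous.continuousOn
  refine ⟨max M₀ C, fun x => ?_⟩
  by_cases hx : x ∈ Metric.closedBall (0 : Plane) (n + 1)
  · exact ((le_abs_self _).trans (hM₀ x hx)).trans (le_max_left _ _)
  · have hsub : Metric.closedBall x 1 ⊆ (Metric.closedBall (0 : Plane) n)ᶜ := by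
      intro z hz hz'
      refine hx ?_
      rw [Metric.mem_closedBall] at *
      linarith [dist_triangle x z 0, dist_comm x z]
    have h1 : ∫ z in Metric.closedBall x 1, Real.exp (u z) ≤ ε :=
      (setIntegral_mono_set hint.integrableOn
        (Filter.Eventually.of_forall fun z => (Real.exp_pos _).le) hsub.eventuallyLE).trans hn.le
    have h2 := hC (fun y => Real.exp (u y)) hu.exp (fun y => (Real.exp_pos _).le) hint
      (laplacian_exp_ge hu heq) x h1
    have h3 := Real.add_one_le_exp (u x)
    exact le_trans (by linarith) (le_max_right _ _)

/-- Solutions bounded above with finite mass grow at most like `√‖x‖`. -/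
theorem exists_sq_growth_bound {K : ℝ} (hK : 0 < K) {u : Plane → ℝ} (hu : ContDiff ℝ 2 u)
    (heq : ∀ x, pd 0 (pd 0 u) x + pd 1 (pd 1 u) x = -(K * Real.exp (u x)))
    (hint : Integrable fun x => Real.exp (u x)) : ∃ A, ∀ x, u x ^ 2 ≤ A * (1 + ‖x‖) := by
  obtain ⟨M, hM⟩ := exists_upper_bound hK hu heq hint
  obtain ⟨f, hf⟩ : ∃ f : Plane → ℝ, f = fun x => M - u x := ⟨_, rfl⟩
  have hf0 (x) : 0 ≤ f x := by simp [hf, hM x]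
  have hfc : ContDiff ℝ 2 f := hf ▸ contDiff_const.sub hu
  have hd : Differentiable ℝ u := hu.differentiable (by norm_num)
  have hfΔ (x) : pd 0 (pd 0 f) x + pd 1 (pd 1 f) x = K * Real.exp (u x) := by
    have e1 (i : Fin 2) : pd i f = fun x => -1 * pd i u x := by
      ext y
      rw [hf, ← pd_const_mul _ (hd y)]
      unfold pd
      rw [fderiv_const_sub]
      simp [fderiv_fun_neg]
    have e2 (i : Fin 2) : pd i (pd i f) x = -pd i (pd i u) x := by
      rw [e1, pd_const_mul _ ((pd_contDiff_one hu).differentiable (by norm_num) x)]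
      ring
    rw [e2, e2]
    linarith [heq x]
  obtain ⟨I, hI⟩ : ∃ I, I = ∫ x, Real.exp (u x) := ⟨_, rfl⟩
  have hI0 : 0 ≤ I := hI ▸ integral_nonneg fun x => (Real.exp_pos _).le
  obtain ⟨m, hm⟩ : ∃ m : ℝ → ℝ, m = fun r => ∫ y, f ((0 : Plane) + r • y) * cutoff y := ⟨_, rfl⟩
  have hk : Continuous cutoff := (cutoff_contDiff (n := 0)).continuous
  have hfcont := hfc.continuous
  have hm0 (r) : 0 ≤ m r := by
    rw [hm]
    exact integral_nonneg fun y => mul_nonneg (hf0 _) (cutoff_nonneg y)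
  have hmgrow (r : ℝ) (hr : 1 ≤ r) : m r ≤ m 1 + 4 * K * I * √r := by
    have hderiv (t : ℝ) (ht : 0 < t) := (hasDerivAt_weighted_mean hfc 0 t).sub
      ((Real.hasDerivAt_sqrt ht.ne').const_mul (4 * K * I))
    have hanti : AntitoneOn (fun t => m t - 4 * K * I * √t) (Set.Icc 1 r) := by
      rw [hm]
      refine antitoneOn_of_deriv_nonpos (convex_Icc 1 r)
        (fun t ht => (hderiv t (by linarith [ht.1])).continuousAt.continuousWithinAt)
        (fun t ht => ?_) fun t ht => ?_
      · rw [interior_Icc] at ht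
        exact (hderiv t (by linarith [ht.1])).differentiableAt.differentiableWithinAt
      · rw [interior_Icc] at ht
        have ht0 : 0 < t := by linarith [ht.1]
        refine (hderiv t ht0).deriv.trans_le ?_
        simp only [hfΔ]
        have h1 : ∫ y, K * Real.exp (u (0 + t • y)) * cutoffPotential y ≤
            K * 2 * ((t ^ 2)⁻¹ * I) := by
          rw [hI, ← integral_comp_affine _ 0, ← integral_const_mul]
          have hΨ : Continuous cutoffPotential := cutoffPotential_contDiff.continuous
          have := hu.continuous
          refine integral_mono ?_ ((integrable_comp_affine hint 0 ht0.ne').const_mul _) fun y => ?_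
          · exact Continuous.integrable_of_hasCompactSupport (by fun_prop)
              cutoffPotential_hasCompactSupport.mul_left
          · have := mul_le_mul_of_nonneg_left (cutoffPotential_le_two y)
              (by positivity : 0 ≤ K * Real.exp (u (0 + t • y)))
            simp only
            linarith
        have h2 : t * (K * 2 * ((t ^ 2)⁻¹ * I)) ≤ 4 * K * I * (1 / (2 * √t)) := by
          have hs : 0 < √t := Real.sqrt_pos.2 ht0
          have hst : √t ≤ t := by
            rw [Real.sqrt_le_left ht0.le]; nlinarith [ht.1]
          have : t⁻¹ ≤ (√t)⁻¹ := inv_anti₀ hs hst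
          calc t * (K * 2 * ((t ^ 2)⁻¹ * I)) = 2 * K * I * t⁻¹ := by field_simp
            _ ≤ 2 * K * I * (√t)⁻¹ := by gcongr
            _ = _ := by field_simp; ring
        linarith [mul_le_mul_of_nonneg_left h1 ht0.le]
    have h := hanti (Set.left_mem_Icc.2 hr) (Set.right_mem_Icc.2 hr) hr
    have h3 : 0 ≤ 4 * K * I * √1 := by positivity
    simp only at h
    linarith
  obtain ⟨c₀, hc₀⟩ : ∃ c₀, c₀ = ∫ y, cutoff y := ⟨_, rfl⟩
  have hc₀pos : 0 < c₀ := hc₀ ▸ integral_cutoff_pos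
  have hfm (x : Plane) : c₀ * f x ≤ 9 * m (3 * (1 + ‖x‖)) := by
    set R := 1 + ‖x‖ with hR
    have hRpos : 0 < R := by positivity
    have hmv := mean_value_ineq hfc (x₀ := x) (r := R) (B := 0) hRpos.le fun z _ => by
      rw [hfΔ, neg_zero]; positivity
    rw [← hc₀] at hmv
    have h1 : ∫ y, f (x + R • y) * cutoff y ≤ 9 * m (3 * R) := by
      have e1 : ∫ y, f (x + R • y) * cutoff y =
          (R ^ 2)⁻¹ * ∫ z, f z * cutoff (R⁻¹ • (z - x)) := by
        rw [← integral_comp_affine _ x]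
        simp [smul_smul, hRpos.ne']
      have e2 : 9 * m (3 * R) = (R ^ 2)⁻¹ * ∫ z, f z * cutoff ((3 * R)⁻¹ • z) := by
        have : ∫ y, f (0 + (3 * R) • y) * cutoff y =
            ((3 * R) ^ 2)⁻¹ * ∫ z, f z * cutoff ((3 * R)⁻¹ • z) := by
          rw [← integral_comp_affine _ 0]
          have h3R : 3 * R ≠ 0 := by positivity
          simp only [zero_add, smul_smul, inv_mul_cancel₀ h3R, one_smul]
        rw [hm]
        simp only
        rw [this]
        field_simp
        norm_num
      rw [e1, e2]
      have hsupp1 : HasCompactSupport fun z : Plane => cutoff (R⁻¹ • (z - x)) := by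
        refine HasCompactSupport.intro (isCompact_closedBall x (2 * R)) fun z hz =>
          cutoff_eq_zero fun h => hz ?_
        rw [mem_closedBall_zero_iff, norm_smul, norm_inv, Real.norm_eq_abs, abs_of_pos hRpos,
          inv_mul_le_iff₀ hRpos] at h
        rw [mem_closedBall_iff_norm]
        linarith
      have hsupp2 : HasCompactSupport fun z : Plane => cutoff ((3 * R)⁻¹ • z) := by
        refine HasCompactSupport.intro (isCompact_closedBall 0 (6 * R)) fun z hz =>
          cutoff_eq_zero fun h => hz ?_
        rw [mem_closedBall_zero_iff, norm_smul, norm_inv, Real.norm_eq_abs,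
          abs_of_pos (by positivity), inv_mul_le_iff₀ (by positivity)] at h
        rw [mem_closedBall_zero_iff]
        linarith
      refine mul_le_mul_of_nonneg_left (integral_mono ?_ ?_ fun z => ?_) (by positivity)
      · exact Continuous.integrable_of_hasCompactSupport (by fun_prop) hsupp1.mul_left
      · exact Continuous.integrable_of_hasCompactSupport (by fun_prop) hsupp2.mul_left
      · refine mul_le_mul_of_nonneg_left ?_ (hf0 z)
        by_cases hz : R⁻¹ • (z - x) ∈ Metric.closedBall (0 : Plane) 2
        · refine (cutoff_le_one _).trans_eq (cutoff_eq_one ?_).symm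
          rw [mem_closedBall_zero_iff, norm_smul, norm_inv, Real.norm_eq_abs, abs_of_pos hRpos,
            inv_mul_le_iff₀ hRpos] at hz
          rw [norm_smul, norm_inv, Real.norm_eq_abs,
            abs_of_pos (by positivity), inv_mul_le_iff₀ (by positivity)]
          have := norm_le_norm_add_norm_sub' z x
          linarith
        · rw [cutoff_eq_zero hz]
          exact cutoff_nonneg _
    linarith
  obtain ⟨A, hA⟩ : ∃ A, A = |M| + 9 / c₀ * (m 1 + 8 * K * I) := ⟨_, rfl⟩
  refine ⟨A ^ 2, fun x => ?_⟩
  have hR1 : 1 ≤ 1 + ‖x‖ := by linarith [norm_nonneg x]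
  have hs1 : 1 ≤ √(1 + ‖x‖) := Real.one_le_sqrt.2 hR1
  have hs3 : √(3 * (1 + ‖x‖)) ≤ 2 * √(1 + ‖x‖) := by
    rw [Real.sqrt_le_left (by positivity), mul_pow, Real.sq_sqrt (by positivity)]
    linarith
  have h1 : c₀ * f x ≤ 9 * (m 1 + 8 * K * I) * √(1 + ‖x‖) := by
    have h2 := hmgrow (3 * (1 + ‖x‖)) (by linarith)
    have h3 : 4 * K * I * √(3 * (1 + ‖x‖)) ≤ 4 * K * I * (2 * √(1 + ‖x‖)) := by gcongr
    have h4 := mul_le_mul_of_nonneg_left hs1 (hm0 1)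
    linarith [hfm x]
  have h2 : f x ≤ 9 / c₀ * (m 1 + 8 * K * I) * √(1 + ‖x‖) := by
    refine le_of_mul_le_mul_left (h1.trans_eq ?_) hc₀pos
    field_simp
  have h3 : |u x| ≤ A * √(1 + ‖x‖) := by
    have h4 : u x = M - f x := by simp [hf]
    have h5 : |u x| ≤ |M| + f x := by
      rw [h4]
      exact (abs_sub _ _).trans_eq (by rw [abs_of_nonneg (hf0 x)])
    have h6 := mul_le_mul_of_nonneg_left hs1 (abs_nonneg M)
    rw [hA]
    linarith
  calc u x ^ 2 = |u x| ^ 2 := (sq_abs _).symm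
    _ ≤ (A * √(1 + ‖x‖)) ^ 2 := by gcongr
    _ = A ^ 2 * (1 + ‖x‖) := by rw [mul_pow, Real.sq_sqrt (by positivity)]

theorem integrable_mul_of_compact {f g : Plane → ℝ} (hf : Continuous f) (hg : Continuous g)
    (hc : HasCompactSupport g) : Integrable fun x => f x * g x :=
  (hf.mul hg).integrable_of_hasCompactSupport hc.mul_left

theorem abs_integral_pd_pd_mul_le {i j : Fin 2} {f g : Plane → ℝ} {L : ℝ} (hf : ContDiff ℝ 2 f)
    (hg : ContDiff ℝ 2 g) (hgs : ∀ y ∉ Metric.closedBall (0 : Plane) 2, g y = 0)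
    (hL : ∀ y ∈ Metric.closedBall (0 : Plane) 2, |f y| ≤ L) :
    |∫ x, pd i (pd j f) x * g x| ≤ L * ∫ x, |pd j (pd i g) x| := by
  have hgc : HasCompactSupport g := HasCompactSupport.intro (isCompact_closedBall 0 2) hgs
  have hz : ∀ y ∉ Metric.closedBall (0 : Plane) 2, pd j (pd i g) y = 0 := by
    intro y hy
    have h1 : tsupport g ⊆ Metric.closedBall 0 2 :=
      closure_minimal (fun x hx => by_contra fun h => hx (hgs x h)) Metric.isClosed_closedBall
    have hU : (Metric.closedBall (0 : Plane) 2)ᶜ ∈ nhds y :=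
      Metric.isClosed_closedBall.isOpen_compl.mem_nhds hy
    have h2 : pd i g =ᶠ[nhds y] fun _ => 0 := by
      filter_upwards [hU] with z hz
      have h3 : g =ᶠ[nhds z] fun _ => 0 := by
        filter_upwards [Metric.isClosed_closedBall.isOpen_compl.mem_nhds hz] with x hx
        exact hgs x hx
      unfold pd
      rw [h3.fderiv_eq]
      simp
    unfold pd at h2 ⊢
    rw [h2.fderiv_eq]
    simp
  have hcont : Continuous (pd j (pd i g)) := pd_pd_continuous hg
  have hcs : HasCompactSupport (pd j (pd i g)) := pd_hasCompactSupport (pd_hasCompactSupport hgc)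
  rw [integral_pd_pd_mul hf hg hgc, ← integral_const_mul]
  refine abs_integral_le_integral_abs.trans (integral_mono ?_ ?_ fun y => ?_)
  · exact (integrable_mul_of_compact hf.continuous hcont hcs).norm
  · exact (hcont.integrable_of_hasCompactSupport hcs).norm.const_mul L
  · simp only [abs_mul]
    by_cases hy : y ∈ Metric.closedBall (0 : Plane) 2
    · exact mul_le_mul_of_nonneg_right (hL y hy) (abs_nonneg _)
    · simp [hz y hy]

theorem integral_norm_grad_sq_le {K J L : ℝ} (hK : 0 ≤ K) {u : Plane → ℝ} (hu : ContDiff ℝ 2 u)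
    (heq : ∀ x, pd 0 (pd 0 u) x + pd 1 (pd 1 u) x = -(K * Real.exp (u x)))
    (hint : Integrable fun x => Real.exp (u x)) (hJ : ∫ x, Real.exp (u x) ≤ J) (hL0 : 0 ≤ L)
    (hL : ∀ y ∈ Metric.closedBall (0 : Plane) 2, |u y| ≤ L) :
    ∫ x, (pd 0 u x ^ 2 + pd 1 u x ^ 2) * cutoff x ≤
      L ^ 2 * ((∫ x, |pd 0 (pd 0 cutoff) x|) + ∫ x, |pd 1 (pd 1 cutoff) x|) + K * L * J := by
  have hd : Differentiable ℝ u := hu.differentiable (by norm_num)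
  have hpc (i : Fin 2) : Continuous (pd i u) := pd_continuous (hu.of_le (by norm_num))
  have hppc (i : Fin 2) : Continuous (pd i (pd i u)) := pd_pd_continuous hu
  have hk : ContDiff ℝ 2 cutoff := cutoff_contDiff
  have hsq : ContDiff ℝ 2 fun x => u x * u x := hu.mul hu
  have e (i : Fin 2) (x) : pd i (pd i fun x => u x * u x) x =
      2 * (pd i u x ^ 2 + u x * pd i (pd i u) x) := by
    have hp : DifferentiableAt ℝ (pd i u) x :=
      (pd_contDiff_one hu).differentiable (by norm_num) x
    rw [show pd i (fun x => u x * u x) = fun x => 2 * (u x * pd i u x) from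
      funext fun y => by rw [pd_mul (hd y) (hd y)]; ring, pd_const_mul _ ((hd x).fun_mul hp),
      pd_mul (hd x) hp]
    ring
  have b (i : Fin 2) := (le_abs_self _).trans (abs_integral_pd_pd_mul_le (i := i) (j := i)
    (L := L ^ 2) hsq hk (fun y => cutoff_eq_zero) fun y hy => by
      rw [← pow_two, abs_pow]; exact pow_le_pow_left₀ (abs_nonneg _) (hL y hy) 2)
  have i1 (i : Fin 2) : Integrable fun x => pd i (pd i fun x => u x * u x) x * cutoff x :=
    integrable_mul_of_compact (pd_pd_continuous hsq) hk.continuous cutoff_hasCompactSupport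
  have i2 : Integrable fun x => K * L * Real.exp (u x) := hint.const_mul _
  have hcomp : ∫ x, (pd 0 u x ^ 2 + pd 1 u x ^ 2) * cutoff x ≤
      ∫ x, ((pd 0 (pd 0 fun x => u x * u x) x * cutoff x +
        pd 1 (pd 1 fun x => u x * u x) x * cutoff x) * (1 / 2) + K * L * Real.exp (u x)) := by
    refine integral_mono ?_ ((((i1 0).add (i1 1)).mul_const _).add i2) fun x => ?_
    · have := hpc 0
      have := hpc 1
      exact integrable_mul_of_compact (by fun_prop) hk.continuous cutoff_hasCompactSupport
    · have h1 : u x * cutoff x * (K * Real.exp (u x)) ≤ L * (K * Real.exp (u x)) := by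
        refine mul_le_mul_of_nonneg_right ?_ (by positivity)
        by_cases hy : x ∈ Metric.closedBall (0 : Plane) 2
        · have h2 := (abs_le.1 (hL x hy)).2
          have h3 := mul_le_mul_of_nonneg_right h2 (cutoff_nonneg x)
          have h4 := mul_le_mul_of_nonneg_left (cutoff_le_one x) hL0
          linarith
        · simp [cutoff_eq_zero hy, hL0]
      have h5 : u x * cutoff x * (pd 0 (pd 0 u) x + pd 1 (pd 1 u) x) =
          u x * cutoff x * -(K * Real.exp (u x)) := by rw [heq]
      simp only [e]
      linarith
  refine hcomp.trans ?_
  rw [integral_add (((i1 0).fun_add (i1 1)).mul_const _) i2, integral_mul_const,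
    integral_add (i1 0) (i1 1), integral_const_mul]
  have h6 := mul_le_mul_of_nonneg_left hJ (mul_nonneg hK hL0)
  have h7 : 0 ≤ L ^ 2 * ∫ x, |pd 0 (pd 0 cutoff) x| :=
    mul_nonneg (sq_nonneg L) (integral_nonneg fun x => abs_nonneg _)
  have h8 : 0 ≤ L ^ 2 * ∫ x, |pd 1 (pd 1 cutoff) x| :=
    mul_nonneg (sq_nonneg L) (integral_nonneg fun x => abs_nonneg _)
  linarith [b 0, b 1]

/-- Real part (up to a factor) of the Hopf-type differential `u_zz - u_z² / 2`. -/
noncomputable def hopfRe (i j : Fin 2) (u : Plane → ℝ) (x : Plane) : ℝ :=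
  pd i (pd i u) x - pd j (pd j u) x - (pd i u x ^ 2 - pd j u x ^ 2) / 2

/-- Imaginary part (up to a factor) of the Hopf-type differential `u_zz - u_z² / 2`. -/
noncomputable def hopfIm (i j : Fin 2) (u : Plane → ℝ) (x : Plane) : ℝ :=
  2 * pd i (pd j u) x - pd i u x * pd j u x

theorem hopfRe_continuous {i j : Fin 2} {u : Plane → ℝ} (hu : ContDiff ℝ 2 u) :
    Continuous (hopfRe i j u) := by
  have h1 (k : Fin 2) : Continuous (pd k u) := pd_continuous (hu.of_le (by norm_num))
  have h2 (k : Fin 2) : Continuous (pd k (pd k u)) := pd_pd_continuous hu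
  have := h1 i
  have := h1 j
  have := h2 i
  have := h2 j
  unfold hopfRe
  fun_prop

theorem hopfIm_continuous {i j : Fin 2} {u : Plane → ℝ} (hu : ContDiff ℝ 2 u) :
    Continuous (hopfIm i j u) := by
  have h1 (k : Fin 2) : Continuous (pd k u) := pd_continuous (hu.of_le (by norm_num))
  have := h1 i
  have := h1 j
  have : Continuous (pd i (pd j u)) := pd_pd_continuous hu
  unfold hopfIm
  fun_prop

/-- The Hopf-type differential satisfies the Cauchy–Riemann equations weakly. -/
theorem hopf_weak_cauchyRiemann {i j : Fin 2} {K : ℝ} {u a : Plane → ℝ} (hu : ContDiff ℝ 2 u)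
    (heq : ∀ x, pd i (pd i u) x + pd j (pd j u) x = -(K * Real.exp (u x)))
    (ha : ContDiff ℝ 2 a) (hc : HasCompactSupport a) :
    (∫ x, hopfRe i j u x * pd i a x) + ∫ x, hopfIm i j u x * pd j a x = 0 := by
  have hd : Differentiable ℝ u := hu.differentiable (by norm_num)
  have hu1 (k : Fin 2) : ContDiff ℝ 1 (pd k u) := pd_contDiff_one hu
  have hp (k : Fin 2) (x) : DifferentiableAt ℝ (pd k u) x :=
    (hu1 k).differentiable (by norm_num) x
  have ha1 (k : Fin 2) : ContDiff ℝ 1 (pd k a) := pd_contDiff_one ha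
  have hac (k : Fin 2) : HasCompactSupport (pd k a) := pd_hasCompactSupport hc
  have ha' : ContDiff ℝ 1 a := ha.of_le (by norm_num)
  have hmain : ∫ x, pd i (pd j u) x * pd j a x = ∫ x, pd j (pd j u) x * pd i a x := by
    rw [integral_pd_mul (hu1 j) (ha1 j) (hac j), integral_pd_mul (hu1 j) (ha1 i) (hac i),
      pd_comm ha]
  have hexp := integral_pd_mul (i := i) (hu.exp.of_le (by norm_num)) ha' hc
  have hquad1 := integral_pd_mul (i := i) (f := fun x => pd i u x * pd i u x - pd j u x * pd j u x)
    (((hu1 i).mul (hu1 i)).sub ((hu1 j).mul (hu1 j))) ha' hc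
  have hquad2 := integral_pd_mul (i := j) (f := fun x => pd i u x * pd j u x)
    ((hu1 i).mul (hu1 j)) ha' hc
  have e1 (x) : pd i (fun x => pd i u x * pd i u x - pd j u x * pd j u x) x =
      2 * (pd i u x * pd i (pd i u) x) - 2 * (pd j u x * pd i (pd j u) x) := by
    rw [pd_sub ((hp i x).fun_mul (hp i x)) ((hp j x).fun_mul (hp j x)), pd_mul (hp i x) (hp i x),
      pd_mul (hp j x) (hp j x)]
    ring
  have e2 (x) : pd j (fun x => pd i u x * pd j u x) x =
      pd i u x * pd j (pd j u) x + pd i (pd j u) x * pd j u x := by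
    rw [pd_mul (hp i x) (hp j x), pd_comm (i := j) (j := i) hu]
  have e3 (x) : pd i (fun x => Real.exp (u x)) x = Real.exp (u x) * pd i u x := pd_exp (hd x)
  simp only [e1] at hquad1
  simp only [e2] at hquad2
  simp only [e3] at hexp
  have c1 (k : Fin 2) : Continuous (pd k u) := (hu1 k).continuous
  have c2 (k l : Fin 2) : Continuous (pd k (pd l u)) := pd_pd_continuous hu
  have int {f : Plane → ℝ} (k : Fin 2) (hf : Continuous f) :
      Integrable fun x => f x * pd k a x :=
    integrable_mul_of_compact hf (ha1 k).continuous (hac k)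
  have int' {f : Plane → ℝ} (hf : Continuous f) : Integrable fun x => f x * a x :=
    integrable_mul_of_compact hf ha.continuous hc
  have d1 := c1 i
  have d2 := c1 j
  have d3 := c2 i i
  have d4 := c2 i j
  have d5 := c2 j j
  have d6 := hu.continuous
  have s1 : ∫ x, hopfRe i j u x * pd i a x =
      ∫ x, (-K * (Real.exp (u x) * pd i a x) - 2 * (pd j (pd j u) x * pd i a x) -
        1 / 2 * ((pd i u x * pd i u x - pd j u x * pd j u x) * pd i a x)) := by
    congr 1 with x
    have := congrArg (· * pd i a x) (heq x)
    beta_reduce at this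
    unfold hopfRe
    linarith
  have s2 : ∫ x, hopfIm i j u x * pd j a x =
      ∫ x, (2 * (pd i (pd j u) x * pd j a x) - pd i u x * pd j u x * pd j a x) := by
    congr 1 with x
    unfold hopfIm
    ring
  have s3 : ∫ x, (2 * (pd i u x * pd i (pd i u) x) - 2 * (pd j u x * pd i (pd j u) x)) * a x =
      ∫ x, (-(2 * K) * (Real.exp (u x) * pd i u x * a x) -
        2 * ((pd i u x * pd j (pd j u) x + pd i (pd j u) x * pd j u x) * a x)) := by
    congr 1 with x
    have := congrArg (· * (pd i u x * a x)) (heq x)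
    beta_reduce at this
    linarith
  rw [s3, integral_sub ((int' (by fun_prop)).const_mul _) ((int' (by fun_prop)).const_mul _),
    integral_const_mul, integral_const_mul] at hquad1
  rw [s1, s2, integral_sub (Integrable.sub' ((int i (by fun_prop)).const_mul _)
      ((int i (by fun_prop)).const_mul _)) ((int i (by fun_prop)).const_mul _),
    integral_sub ((int i (by fun_prop)).const_mul _) ((int i (by fun_prop)).const_mul _),
    integral_sub ((int j (by fun_prop)).const_mul _) (int j (by fun_prop)),
    integral_const_mul, integral_const_mul, integral_const_mul, integral_const_mul]
  linear_combination 2 * hmain - hquad1 / 2 - K * hexp - hquad2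

theorem cutoff_smul_hasCompactSupport {s : ℝ} (hs : 0 < s) :
    HasCompactSupport fun z : Plane => cutoff (s • z) := by
  refine HasCompactSupport.intro (isCompact_closedBall 0 (2 / s)) fun z hz =>
    cutoff_eq_zero fun h => hz ?_
  rw [mem_closedBall_zero_iff, norm_smul, Real.norm_eq_abs, abs_of_pos hs] at h
  rw [mem_closedBall_zero_iff, le_div_iff₀ hs]
  linarith

theorem cutoff_smul_contDiff {s : ℝ} : ContDiff ℝ 2 fun z : Plane => cutoff (s • z) :=
  (cutoff_contDiff (n := 2)).comp (contDiff_const_smul s)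

theorem coord_contDiff {n : WithTop ℕ∞} (i : Fin 2) : ContDiff ℝ n fun z : Plane => z i :=
  (EuclideanSpace.proj i : Plane →L[ℝ] ℝ).contDiff

theorem coord_mul_cutoff_contDiff {s : ℝ} (i : Fin 2) :
    ContDiff ℝ 2 fun z : Plane => z i * cutoff (s • z) :=
  (coord_contDiff i).mul cutoff_smul_contDiff

theorem pd_coord_mul_cutoff {s : ℝ} (i j : Fin 2) (z : Plane) :
    pd i (fun z : Plane => z j * cutoff (s • z)) z =
      z j * (s * pd i cutoff (s • z)) + (if i = j then 1 else 0) * cutoff (s • z) := by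
  have h := pd_comp_affine (i := i) 0 s ((cutoff_contDiff (n := 1)).differentiable (by norm_num))
  simp only [zero_add] at h
  rw [pd_mul ((coord_contDiff (n := 1) j).differentiable (by norm_num) z)
    (cutoff_smul_contDiff.differentiable (by norm_num) z), pd_coord, h]

/-- A continuous function annihilating the divergences of all dilated radial fields has
scale-invariant weighted means; if these tend to `0` at large scales, it vanishes at `0`. -/
theorem eq_zero_of_weighted_mean_tendsto {w : Plane → ℝ} (hw : Continuous w)
    (hdiv : ∀ s : ℝ, 0 < s →
      (∫ z, w z * pd 0 (fun z : Plane => z 0 * cutoff (s • z)) z) +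
        ∫ z, w z * pd 1 (fun z : Plane => z 1 * cutoff (s • z)) z = 0)
    (hlim : Filter.Tendsto (fun r : ℝ => ∫ y, w (r • y) * cutoff y) Filter.atTop (nhds 0)) :
    w 0 = 0 := by
  have hk : Continuous cutoff := (cutoff_contDiff (n := 0)).continuous
  have hpk (i : Fin 2) : Continuous (pd i cutoff) := pd_continuous cutoff_contDiff
  have hpk0 (i : Fin 2) {y : Plane} (hy : y ∉ Metric.closedBall (0 : Plane) 2) :
      pd i cutoff y = 0 := by
    have h3 : cutoff =ᶠ[nhds y] fun _ => 0 := by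
      filter_upwards [Metric.isClosed_closedBall.isOpen_compl.mem_nhds hy] with x hx
      exact cutoff_eq_zero hx
    unfold pd
    rw [h3.fderiv_eq]
    simp
  have hderiv (s : ℝ) (hs : 0 < s) :
      HasDerivAt (fun s : ℝ => s ^ 2 * ∫ z, w z * cutoff (s • z)) 0 s := by
    have hnot {t : ℝ} (ht : t ∈ Metric.ball s (s / 2)) {z : Plane}
        (hz : z ∉ Metric.closedBall (0 : Plane) (4 / s)) :
        t • z ∉ Metric.closedBall (0 : Plane) 2 := by
      rw [Metric.mem_ball, Real.dist_eq, abs_lt] at ht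
      rw [mem_closedBall_zero_iff, not_le] at *
      rw [div_lt_iff₀ hs] at hz
      rw [norm_smul, Real.norm_eq_abs, abs_of_pos (by linarith)]
      nlinarith [norm_nonneg z]
    have key := hasDerivAt_integral_of_compact (r₀ := s) (ε := s / 2)
      (F := fun s z => w z * cutoff (s • z))
      (F' := fun s z => w z * (pd 0 cutoff (s • z) * z 0 + pd 1 cutoff (s • z) * z 1))
      (by positivity) (isCompact_closedBall (0 : Plane) (4 / s)) (fun r => by fun_prop)
      (by
        have := hpk 0
        have := hpk 1
        simp only [Function.uncurry_def]
        fun_prop)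
      (fun y hy => by
        simp [cutoff_eq_zero (hnot (Metric.mem_ball_self (by positivity)) hy)])
      (fun r hr y hy => by simp [hpk0 _ (hnot hr hy)])
      (fun r y => by
        have h1 : HasDerivAt (fun s : ℝ => s • y) y r := by
          simpa using (hasDerivAt_id r).smul_const y
        have h2 := (((cutoff_contDiff (n := 1)).differentiable (by norm_num))
          (r • y)).hasFDerivAt.comp_hasDerivAt r h1
        rw [fderiv_apply_eq_sum_pd] at h2
        exact h2.const_mul _)
    refine ((hasDerivAt_pow 2 s).mul key).congr_deriv ?_
    have hi (i : Fin 2) : Integrable fun z =>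
        w z * pd i (fun z : Plane => z i * cutoff (s • z)) z :=
      integrable_mul_of_compact hw
        (pd_continuous ((coord_mul_cutoff_contDiff i).of_le (by norm_num)))
        (pd_hasCompactSupport (cutoff_smul_hasCompactSupport hs).mul_left)
    have h := hdiv s hs
    rw [← integral_add (hi 0) (hi 1)] at h
    have hsplit : ∫ z, (w z * pd 0 (fun z : Plane => z 0 * cutoff (s • z)) z +
        w z * pd 1 (fun z : Plane => z 1 * cutoff (s • z)) z) =
        ∫ z, (2 * (w z * cutoff (s • z)) +
          s * (w z * (pd 0 cutoff (s • z) * z 0 + pd 1 cutoff (s • z) * z 1))) := by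
      congr 1 with z
      rw [pd_coord_mul_cutoff, pd_coord_mul_cutoff]
      simp only [if_true]
      ring
    have hI1 : Integrable fun z => w z * cutoff (s • z) :=
      integrable_mul_of_compact hw (by fun_prop) (cutoff_smul_hasCompactSupport hs)
    have hI2 : Integrable fun z =>
        w z * (pd 0 cutoff (s • z) * z 0 + pd 1 cutoff (s • z) * z 1) := by
      have := hpk 0
      have := hpk 1
      refine integrable_mul_of_compact hw (by fun_prop)
        (HasCompactSupport.intro (isCompact_closedBall (0 : Plane) (4 / s)) fun z hz => ?_)
      simp [hpk0 _ (hnot (Metric.mem_ball_self (by positivity)) hz)]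
    rw [hsplit, integral_add (hI1.const_mul _) (hI2.const_mul _), integral_const_mul,
      integral_const_mul] at h
    simp only [Nat.cast_ofNat, Nat.add_one_sub_one, pow_one]
    linear_combination s * h
  have hconst : ∀ r : ℝ, 0 < r → ∫ y, w (r • y) * cutoff y = ∫ y, w ((1 : ℝ) • y) * cutoff y := by
    have hchange (r : ℝ) (hr : 0 < r) :
        ∫ y, w (r • y) * cutoff y = r⁻¹ ^ 2 * ∫ z, w z * cutoff (r⁻¹ • z) := by
      have h := integral_comp_affine (fun z => w z * cutoff (r⁻¹ • z)) 0 r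
      simp only [zero_add, smul_smul, inv_mul_cancel₀ hr.ne', one_smul] at h
      rw [h, inv_pow]
    intro r hr
    rw [hchange r hr, hchange 1 one_pos]
    exact (convex_Ioi (0 : ℝ)).is_const_of_fderivWithin_eq_zero (𝕜 := ℝ)
      (f := fun s : ℝ => s ^ 2 * ∫ z, w z * cutoff (s • z))
      (fun s hs => (hderiv s hs).differentiableAt.differentiableWithinAt)
      (fun s hs => by
        rw [fderivWithin_of_isOpen isOpen_Ioi hs, (hderiv s hs).hasFDerivAt.fderiv]
        simp)
      (Set.mem_Ioi.2 (inv_pos.2 hr)) (Set.mem_Ioi.2 (inv_pos.2 one_pos))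
  have hzero : ∀ r : ℝ, 0 < r → ∫ y, w (r • y) * cutoff y = 0 := by
    have h1 : Filter.Tendsto (fun r : ℝ => ∫ y, w (r • y) * cutoff y) Filter.atTop
        (nhds (∫ y, w ((1 : ℝ) • y) * cutoff y)) :=
      tendsto_const_nhds.congr' (by
        filter_upwards [Filter.eventually_gt_atTop 0] with r hr
        exact (hconst r hr).symm)
    intro r hr
    rw [hconst r hr, tendsto_nhds_unique h1 hlim]
  have hcont : Continuous fun r : ℝ => ∫ y, w (r • y) * cutoff y := by
    have h := continuous_parametric_integral_of_continuous (μ := (volume : Measure Plane))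
      (f := fun (r : ℝ) y => w (r • y) * cutoff y)
      (by simp only [Function.uncurry_def]; fun_prop) (isCompact_closedBall (0 : Plane) 2)
    refine h.congr fun r => ?_
    refine setIntegral_eq_integral_of_forall_compl_eq_zero fun y hy => ?_
    rw [cutoff_eq_zero hy, mul_zero]
  have h0 : ∫ y, w ((0 : ℝ) • y) * cutoff y = 0 := by
    refine tendsto_nhds_unique
      (hcont.continuousWithinAt (s := Set.Ioi 0) (x := (0 : ℝ))) ?_
    refine tendsto_const_nhds.congr' ?_
    filter_upwards [self_mem_nhdsWithin] with r hr
    exact (hzero r hr).symm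
  simp only [zero_smul, integral_const_mul] at h0
  exact (mul_eq_zero.1 h0).resolve_right integral_cutoff_pos.ne'

theorem hopf_swap {u : Plane → ℝ} (hu : ContDiff ℝ 2 u) :
    hopfRe 1 0 u = (fun x => -hopfRe 0 1 u x) ∧ hopfIm 1 0 u = hopfIm 0 1 u := by
  constructor
  · ext x
    unfold hopfRe
    ring
  · ext x
    unfold hopfIm
    rw [pd_comm hu]
    ring

theorem hopf_radial_divergence {K : ℝ} {u : Plane → ℝ} (hu : ContDiff ℝ 2 u)
    (heq : ∀ x, pd 0 (pd 0 u) x + pd 1 (pd 1 u) x = -(K * Real.exp (u x))) {s : ℝ} (hs : 0 < s) :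
    ((∫ z, hopfRe 0 1 u z * pd 0 (fun z : Plane => z 0 * cutoff (s • z)) z) +
        ∫ z, hopfRe 0 1 u z * pd 1 (fun z : Plane => z 1 * cutoff (s • z)) z = 0) ∧
    ((∫ z, hopfIm 0 1 u z * pd 0 (fun z : Plane => z 0 * cutoff (s • z)) z) +
        ∫ z, hopfIm 0 1 u z * pd 1 (fun z : Plane => z 1 * cutoff (s • z)) z = 0) := by
  have hc (i : Fin 2) : HasCompactSupport fun z : Plane => z i * cutoff (s • z) :=
    (cutoff_smul_hasCompactSupport hs).mul_left
  have hcross : pd 1 (fun z : Plane => z 0 * cutoff (s • z)) =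
      pd 0 (fun z : Plane => z 1 * cutoff (s • z)) := by
    ext z
    rw [pd_coord_mul_cutoff, pd_coord_mul_cutoff]
    have := cutoff_radial (s • z)
    simp only [PiLp.smul_apply, smul_eq_mul] at this
    simp only [one_ne_zero, zero_ne_one, if_false]
    linear_combination this
  have heq' (x) : pd 1 (pd 1 u) x + pd 0 (pd 0 u) x = -(K * Real.exp (u x)) := by
    rw [add_comm, heq]
  have a1 := hopf_weak_cauchyRiemann hu heq (coord_mul_cutoff_contDiff (s := s) 0) (hc 0)
  have a2 := hopf_weak_cauchyRiemann hu heq' (coord_mul_cutoff_contDiff (s := s) 0) (hc 0)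
  have b1 := hopf_weak_cauchyRiemann hu heq (coord_mul_cutoff_contDiff (s := s) 1) (hc 1)
  have b2 := hopf_weak_cauchyRiemann hu heq' (coord_mul_cutoff_contDiff (s := s) 1) (hc 1)
  simp only [hopf_swap hu, neg_mul, integral_neg, hcross] at a1 a2 b1 b2
  constructor <;> linarith

theorem exists_hopf_mean_bound : ∃ C : ℝ, ∀ (K J L : ℝ) (u : Plane → ℝ), 0 ≤ K →
    ContDiff ℝ 2 u → (∀ x, pd 0 (pd 0 u) x + pd 1 (pd 1 u) x = -(K * Real.exp (u x))) →
    Integrable (fun x => Real.exp (u x)) → ∫ x, Real.exp (u x) ≤ J → 0 ≤ L →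
    (∀ y ∈ Metric.closedBall (0 : Plane) 2, |u y| ≤ L) →
    |∫ x, hopfRe 0 1 u x * cutoff x| ≤ C * (L + L ^ 2) + K * L * J ∧
    |∫ x, hopfIm 0 1 u x * cutoff x| ≤ C * (L + L ^ 2) + K * L * J := by
  obtain ⟨a, ha⟩ : ∃ a, a = ∫ x, |pd 0 (pd 0 cutoff) x| := ⟨_, rfl⟩
  obtain ⟨b, hb⟩ : ∃ b, b = ∫ x, |pd 1 (pd 1 cutoff) x| := ⟨_, rfl⟩
  obtain ⟨c, hc⟩ : ∃ c, c = ∫ x, |pd 1 (pd 0 cutoff) x| := ⟨_, rfl⟩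
  have ha0 : 0 ≤ a := ha ▸ integral_nonneg fun x => abs_nonneg _
  have hb0 : 0 ≤ b := hb ▸ integral_nonneg fun x => abs_nonneg _
  have hc0 : 0 ≤ c := hc ▸ integral_nonneg fun x => abs_nonneg _
  refine ⟨a + b + 2 * c, fun K J L u hK hu heq hint hJ hL0 hL => ?_⟩
  have hk : ContDiff ℝ 2 cutoff := cutoff_contDiff
  have hG := integral_norm_grad_sq_le hK hu heq hint hJ hL0 hL
  have h00 := abs_integral_pd_pd_mul_le (i := 0) (j := 0) hu hk (fun _ => cutoff_eq_zero) hL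
  have h11 := abs_integral_pd_pd_mul_le (i := 1) (j := 1) hu hk (fun _ => cutoff_eq_zero) hL
  have h01 := abs_integral_pd_pd_mul_le (i := 0) (j := 1) hu hk (fun _ => cutoff_eq_zero) hL
  rw [← ha] at h00 hG
  rw [← hb] at h11 hG
  rw [← hc] at h01
  have hpc (i : Fin 2) : Continuous (pd i u) := pd_continuous (hu.of_le (by norm_num))
  have hpc0 := hpc 0
  have hpc1 := hpc 1
  have hppc (i j : Fin 2) : Continuous (pd i (pd j u)) := pd_pd_continuous hu
  have int {f : Plane → ℝ} (hf : Continuous f) : Integrable fun x => f x * cutoff x :=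
    integrable_mul_of_compact hf hk.continuous cutoff_hasCompactSupport
  have hq {f : Plane → ℝ} (hf : Continuous f)
      (hle : ∀ x, |f x| ≤ pd 0 u x ^ 2 + pd 1 u x ^ 2) :
      |∫ x, f x * cutoff x| ≤ ∫ x, (pd 0 u x ^ 2 + pd 1 u x ^ 2) * cutoff x := by
    refine abs_integral_le_integral_abs.trans
      (integral_mono (int hf).abs (int (by fun_prop)) fun x => ?_)
    simp only [abs_mul, abs_of_nonneg (cutoff_nonneg x)]
    exact mul_le_mul_of_nonneg_right (hle x) (cutoff_nonneg x)
  have hq1 := hq (f := fun x => pd 0 u x ^ 2 - pd 1 u x ^ 2) (by fun_prop) fun x => by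
    rw [abs_le]
    constructor <;> nlinarith [sq_nonneg (pd 0 u x), sq_nonneg (pd 1 u x)]
  have hq2 := hq (f := fun x => pd 0 u x * pd 1 u x) (by fun_prop) fun x => by
    rw [abs_le]
    constructor <;> nlinarith [sq_nonneg (pd 0 u x + pd 1 u x), sq_nonneg (pd 0 u x - pd 1 u x),
      sq_nonneg (pd 0 u x), sq_nonneg (pd 1 u x)]
  have eRe : ∫ x, hopfRe 0 1 u x * cutoff x = (∫ x, pd 0 (pd 0 u) x * cutoff x) -
      (∫ x, pd 1 (pd 1 u) x * cutoff x) -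
        1 / 2 * ∫ x, (pd 0 u x ^ 2 - pd 1 u x ^ 2) * cutoff x := by
    rw [← integral_sub (int (hppc 0 0)) (int (hppc 1 1)), ← integral_const_mul,
      ← integral_sub (Integrable.sub' (int (hppc 0 0)) (int (hppc 1 1)))
        ((int (by fun_prop)).const_mul _)]
    congr 1 with x
    unfold hopfRe
    ring
  have eIm : ∫ x, hopfIm 0 1 u x * cutoff x = 2 * (∫ x, pd 0 (pd 1 u) x * cutoff x) -
      ∫ x, (pd 0 u x * pd 1 u x) * cutoff x := by
    rw [← integral_const_mul, ← integral_sub ((int (hppc 0 1)).const_mul _) (int (by fun_prop))]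
    congr 1 with x
    unfold hopfIm
    ring
  have p1 : 0 ≤ L * a := mul_nonneg hL0 ha0
  have p2 : 0 ≤ L * b := mul_nonneg hL0 hb0
  have p3 : 0 ≤ L * c := mul_nonneg hL0 hc0
  have p4 : 0 ≤ L ^ 2 * a := mul_nonneg (sq_nonneg L) ha0
  have p5 : 0 ≤ L ^ 2 * b := mul_nonneg (sq_nonneg L) hb0
  have p6 : 0 ≤ L ^ 2 * c := mul_nonneg (sq_nonneg L) hc0
  rw [abs_le] at h00 h11 h01 hq1 hq2
  rw [eRe, eIm, abs_le, abs_le]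
  refine ⟨⟨?_, ?_⟩, ?_, ?_⟩ <;> linarith

theorem hopf_comp_affine {u : Plane → ℝ} (hu : ContDiff ℝ 2 u) (x₀ : Plane) (r : ℝ) :
    hopfRe 0 1 (fun y => u (x₀ + r • y)) = (fun y => r ^ 2 * hopfRe 0 1 u (x₀ + r • y)) ∧
    hopfIm 0 1 (fun y => u (x₀ + r • y)) = fun y => r ^ 2 * hopfIm 0 1 u (x₀ + r • y) := by
  have hd : Differentiable ℝ u := hu.differentiable (by norm_num)
  constructor
  · ext y
    unfold hopfRe
    rw [pd_pd_comp_affine x₀ r hu, pd_pd_comp_affine x₀ r hu, pd_comp_affine x₀ r hd,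
      pd_comp_affine x₀ r hd]
    ring
  · ext y
    unfold hopfIm
    rw [pd_pd_comp_affine x₀ r hu, pd_comp_affine x₀ r hd, pd_comp_affine x₀ r hd]
    ring

theorem hopf_apply_zero_eq_zero {K : ℝ} (hK : 0 < K) {u : Plane → ℝ} (hu : ContDiff ℝ 2 u)
    (heq : ∀ x, pd 0 (pd 0 u) x + pd 1 (pd 1 u) x = -(K * Real.exp (u x)))
    (hint : Integrable fun x => Real.exp (u x)) : hopfRe 0 1 u 0 = 0 ∧ hopfIm 0 1 u 0 = 0 := by
  obtain ⟨A, hA⟩ := exists_sq_growth_bound hK hu heq hint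
  obtain ⟨C, hC⟩ := exists_hopf_mean_bound
  obtain ⟨I, hI⟩ : ∃ I, I = ∫ x, Real.exp (u x) := ⟨_, rfl⟩
  have hI0 : 0 ≤ I := hI ▸ integral_nonneg fun x => (Real.exp_pos _).le
  have hA0 : 0 ≤ A := by
    have := hA 0
    rw [norm_zero, add_zero, mul_one] at this
    exact (sq_nonneg _).trans this
  obtain ⟨D, hD⟩ : ∃ D, D = 2 * (|C| + K * I) * (1 + 3 * A) := ⟨_, rfl⟩
  have hbound (r : ℝ) (hr : 1 ≤ r) : |∫ y, hopfRe 0 1 u (r • y) * cutoff y| ≤ D * r⁻¹ ∧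
      |∫ y, hopfIm 0 1 u (r • y) * cutoff y| ≤ D * r⁻¹ := by
    have hr0 : 0 < r := by linarith
    obtain ⟨L, hL⟩ : ∃ L, L = √(A * (1 + 2 * r)) := ⟨_, rfl⟩
    have hL0 : 0 ≤ L := hL ▸ Real.sqrt_nonneg _
    have hL2 : L ^ 2 = A * (1 + 2 * r) := hL ▸ Real.sq_sqrt (by positivity)
    have h := hC (K * r ^ 2) ((r ^ 2)⁻¹ * I) L (fun y => u (0 + r • y)) (by positivity)
      (contDiff_comp_affine 0 r hu)
      (fun x => by
        rw [pd_pd_comp_affine 0 r hu, pd_pd_comp_affine 0 r hu]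
        linear_combination r ^ 2 * heq (0 + r • x))
      (integrable_comp_affine hint 0 hr0.ne')
      (by rw [hI, integral_comp_affine (fun x => Real.exp (u x)) 0 r]) hL0
      (fun y hy => by
        rw [hL, ← Real.sqrt_sq_eq_abs]
        refine Real.sqrt_le_sqrt ((hA _).trans (mul_le_mul_of_nonneg_left ?_ hA0))
        rw [mem_closedBall_zero_iff] at hy
        rw [zero_add, norm_smul, Real.norm_eq_abs, abs_of_pos hr0]
        nlinarith)
    have e (X : ℝ) : r ^ 2 * (D * r⁻¹) = D * r := by field_simp
    have hfin : C * (L + L ^ 2) + K * r ^ 2 * L * ((r ^ 2)⁻¹ * I) ≤ r ^ 2 * (D * r⁻¹) := by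
      rw [e 0, show K * r ^ 2 * L * ((r ^ 2)⁻¹ * I) = K * I * L by field_simp]
      have h1 : L + L ^ 2 ≤ 2 * ((1 + 3 * A) * r) := by
        nlinarith [sq_nonneg (L - 1), mul_le_mul_of_nonneg_left hr hA0]
      have h2 : C * (L + L ^ 2) ≤ |C| * (2 * ((1 + 3 * A) * r)) :=
        (mul_le_mul_of_nonneg_right (le_abs_self C) (by positivity)).trans
          (mul_le_mul_of_nonneg_left h1 (abs_nonneg C))
      have h3 : K * I * L ≤ K * I * (2 * ((1 + 3 * A) * r)) :=
        mul_le_mul_of_nonneg_left (by nlinarith [sq_nonneg L]) (by positivity)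
      rw [hD]
      linarith
    rw [(hopf_comp_affine hu 0 r).1, (hopf_comp_affine hu 0 r).2] at h
    simp only [mul_assoc, integral_const_mul, abs_mul, abs_of_pos (pow_pos hr0 2), zero_add] at h
    simp only [mul_assoc] at hfin
    exact ⟨le_of_mul_le_mul_left (h.1.trans hfin) (by positivity),
      le_of_mul_le_mul_left (h.2.trans hfin) (by positivity)⟩
  have hDlim : Filter.Tendsto (fun r : ℝ => D * r⁻¹) Filter.atTop (nhds 0) := by
    simpa using tendsto_inv_atTop_zero.const_mul D
  constructor
  · refine eq_zero_of_weighted_mean_tendsto (hopfRe_continuous hu)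
      (fun s hs => (hopf_radial_divergence hu heq hs).1) (squeeze_zero_norm' ?_ hDlim)
    filter_upwards [Filter.eventually_ge_atTop 1] with r hr
    exact (hbound r hr).1
  · refine eq_zero_of_weighted_mean_tendsto (hopfIm_continuous hu)
      (fun s hs => (hopf_radial_divergence hu heq hs).2) (squeeze_zero_norm' ?_ hDlim)
    filter_upwards [Filter.eventually_ge_atTop 1] with r hr
    exact (hbound r hr).2

/-- Finite mass forces the Hopf-type differential to vanish identically. -/
theorem hopf_eq_zero {K : ℝ} (hK : 0 < K) {u : Plane → ℝ} (hu : ContDiff ℝ 2 u)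
    (heq : ∀ x, pd 0 (pd 0 u) x + pd 1 (pd 1 u) x = -(K * Real.exp (u x)))
    (hint : Integrable fun x => Real.exp (u x)) (x : Plane) :
    hopfRe 0 1 u x = 0 ∧ hopfIm 0 1 u x = 0 := by
  have h := hopf_apply_zero_eq_zero hK (contDiff_comp_affine x 1 hu)
    (fun y => by
      rw [pd_pd_comp_affine x 1 hu, pd_pd_comp_affine x 1 hu]
      linear_combination heq (x + (1 : ℝ) • y))
    (integrable_comp_affine hint x one_ne_zero)
  rw [(hopf_comp_affine hu x 1).1, (hopf_comp_affine hu x 1).2] at h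
  simpa using h

theorem eq_add_single_of_pd_eq_zero {i : Fin 2} {f : Plane → ℝ} (hf : Differentiable ℝ f)
    (h : ∀ x, pd i f x = 0) (x : Plane) (t : ℝ) :
    f (x + t • EuclideanSpace.single i 1) = f x := by
  have hd : ∀ s : ℝ, HasDerivAt (fun s : ℝ => f (x + s • EuclideanSpace.single i 1)) 0 s := by
    intro s
    have h1 : HasDerivAt (fun s : ℝ => x + s • EuclideanSpace.single i (1 : ℝ))
        (EuclideanSpace.single i 1) s := by
      simpa using ((hasDerivAt_id s).smul_const (EuclideanSpace.single i (1 : ℝ))).const_add x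
    have h2 := (hf (x + s • EuclideanSpace.single i 1)).hasFDerivAt.comp_hasDerivAt s h1
    have h3 := h (x + s • EuclideanSpace.single i 1)
    unfold pd at h3
    rwa [h3] at h2
  have := is_const_of_deriv_eq_zero (fun s => (hd s).differentiableAt) (fun s => (hd s).deriv) t 0
  simpa using this

theorem pd_eq_add_single_of_pd_eq_zero {i j : Fin 2} {f : Plane → ℝ} (hf : Differentiable ℝ f)
    (h : ∀ x, pd i f x = 0) (x : Plane) (t : ℝ) :
    pd j f (x + t • EuclideanSpace.single i 1) = pd j f x := by
  unfold pd
  rw [← fderiv_comp_add_right, funext fun y => eq_add_single_of_pd_eq_zero hf h y t]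

theorem eq_apply_zero_of_pd_eq_zero {f : Plane → ℝ} (hf : Differentiable ℝ f)
    (h : ∀ i x, pd i f x = 0) (x : Plane) : f x = f 0 :=
  is_const_of_fderiv_eq_zero hf
    (fun y => by ext v; simp [fderiv_apply_eq_sum_pd, h]) x 0

/-- A function on the plane whose Hessian is a scalar function times the identity is a quadratic
polynomial with constant Hessian. -/
theorem eq_quadratic_of_hessian_scalar {v : Plane → ℝ} (hv : ContDiff ℝ 2 v)
    (hdiag : ∀ x, pd 0 (pd 0 v) x = pd 1 (pd 1 v) x) (hoff : ∀ x, pd 0 (pd 1 v) x = 0)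
    (hcrit : ∀ i, pd i v 0 = 0) (x : Plane) :
    v x = v 0 + pd 0 (pd 0 v) 0 / 2 * ‖x‖ ^ 2 := by
  have hoff' (x : Plane) : pd 1 (pd 0 v) x = 0 := by rw [pd_comm hv]; exact hoff x
  have hd (i : Fin 2) : Differentiable ℝ (pd i v) :=
    (pd_contDiff_one hv).differentiable (by norm_num)
  have hc (j : Fin 2) : Differentiable ℝ (fun y : Plane => y j) :=
    (coord_contDiff (n := 1) j).differentiable (by norm_num)
  set a := pd 0 (pd 0 v) 0 with ha
  have hconst (x : Plane) : pd 0 (pd 0 v) x = a := by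
    have h1 := pd_eq_add_single_of_pd_eq_zero (j := 0) (hd 0) hoff'
      (x 0 • EuclideanSpace.single 0 1) (x 1)
    have h2 := pd_eq_add_single_of_pd_eq_zero (j := 1) (hd 1) hoff 0 (x 0)
    have hx : x 0 • EuclideanSpace.single 0 (1 : ℝ) + x 1 • EuclideanSpace.single 1 (1 : ℝ) = x := by
      ext i; fin_cases i <;> simp
    rw [hx] at h1
    rw [zero_add, ← hdiag, ← hdiag] at h2
    rw [h1, h2]
  have hgrad (i : Fin 2) (x : Plane) : pd i v x = a * x i := by
    have h := eq_apply_zero_of_pd_eq_zero (f := fun y => pd i v y - a * y i)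
      ((hd i).fun_sub ((hc i).const_mul a)) (fun k y => by
        rw [pd_sub (hd i y) ((hc i).const_mul a y), pd_const_mul a (hc i y), pd_coord]
        fin_cases i <;> fin_cases k <;> simp [hoff, hoff', hconst, ← hdiag]) x
    simp only [hcrit, PiLp.zero_apply] at h
    linarith
  have hvd : Differentiable ℝ v := hv.differentiable (by norm_num)
  have hq (j : Fin 2) : Differentiable ℝ (fun y : Plane => y j * y j) := (hc j).fun_mul (hc j)
  have h := eq_apply_zero_of_pd_eq_zero
    (f := fun y => v y - a / 2 * (y 0 * y 0) - a / 2 * (y 1 * y 1))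
    ((hvd.fun_sub ((hq 0).const_mul _)).fun_sub ((hq 1).const_mul _)) (fun k y => by
      rw [pd_sub ((hvd.fun_sub ((hq 0).const_mul _)) y) ((hq 1).const_mul _ y),
        pd_sub (hvd y) ((hq 0).const_mul _ y), pd_const_mul _ (hq 0 y), pd_const_mul _ (hq 1 y),
        pd_mul (hc 0 y) (hc 0 y), pd_mul (hc 1 y) (hc 1 y), pd_coord, pd_coord, hgrad]
      fin_cases k <;> simp <;> ring) x
  simp only [PiLp.zero_apply] at h
  rw [EuclideanSpace.real_norm_sq_eq, Fin.sum_univ_two]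
  linarith

theorem pd_pd_exp_const_mul {i j : Fin 2} {u : Plane → ℝ} (hu : ContDiff ℝ 2 u) (c : ℝ)
    (x : Plane) :
    pd i (pd j (fun y => Real.exp (c * u y))) x =
      Real.exp (c * u x) * (c * pd i (pd j u) x + c ^ 2 * (pd i u x * pd j u x)) := by
  have hd : Differentiable ℝ u := hu.differentiable (by norm_num)
  have hdj : Differentiable ℝ (pd j u) := (pd_contDiff_one hu).differentiable (by norm_num)
  have hcu : Differentiable ℝ (fun y => c * u y) := hd.const_mul c
  have h1 : pd j (fun y => Real.exp (c * u y)) = fun y => Real.exp (c * u y) * (c * pd j u y) := by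
    ext y
    rw [pd_exp (hcu y), pd_const_mul c (hd y)]
  rw [h1, pd_mul (hcu.exp x) (hdj.const_mul c x), pd_exp (hcu x), pd_const_mul c (hd x),
    pd_const_mul c (hdj x)]
  ring

theorem eq_neg_two_log_of_hopf_eq_zero {K : ℝ} {u : Plane → ℝ} (hu : ContDiff ℝ 2 u)
    (heq : ∀ x, pd 0 (pd 0 u) x + pd 1 (pd 1 u) x = -(K * Real.exp (u x)))
    (hopf : ∀ x, hopfRe 0 1 u x = 0 ∧ hopfIm 0 1 u x = 0)
    (h0 : u 0 = 0) (hcrit : ∀ i, pd i u 0 = 0) (x : Plane) :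
    u x = -2 * Real.log (1 + (K / 8) * ‖x‖ ^ 2) := by
  have hd : Differentiable ℝ u := hu.differentiable (by norm_num)
  have h := eq_quadratic_of_hessian_scalar (v := fun y => Real.exp (-(1 / 2) * u y))
    (contDiff_const.mul hu).exp
    (fun y => by
      rw [pd_pd_exp_const_mul hu, pd_pd_exp_const_mul hu]
      have := (hopf y).1
      unfold hopfRe at this
      linear_combination (-(1 / 2) * Real.exp (-(1 / 2) * u y)) * this)
    (fun y => by
      rw [pd_pd_exp_const_mul hu]
      have := (hopf y).2
      unfold hopfIm at this
      rw [pd_comm hu] at this ⊢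
      linear_combination (-(1 / 4) * Real.exp (-(1 / 2) * u y)) * this)
    (fun i => by rw [pd_exp ((hd.const_mul _) 0), pd_const_mul _ (hd 0), hcrit]; simp) x
  have hlap : pd 0 (pd 0 u) 0 = -(K / 2) := by
    have h1 := (hopf 0).1
    have h2 := heq 0
    simp only [hopfRe, hcrit] at h1
    rw [h0, Real.exp_zero] at h2
    linarith
  rw [pd_pd_exp_const_mul hu, hlap, h0] at h
  simp only [hcrit, mul_zero, Real.exp_zero] at h
  rw [show 1 + K / 8 * ‖x‖ ^ 2 = Real.exp (-(1 / 2) * u x) by rw [h]; ring, Real.log_exp]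
  ring

/- STATEMENT 5 (Chen–Li classification): if `K > 0` and `u ∈ C²(ℝ²)` solves
`-Δu = K e^u` with `u(0) = 0`, `∇u(0) = 0` and `∫_{ℝ²} e^u < ∞`, then
`u(x) = -2 log(1 + (K/8)|x|²)`. -/
theorem stmt5 (K : ℝ) (hK : 0 < K) (u : EuclideanSpace ℝ (Fin 2) → ℝ)
    (hu : ContDiff ℝ 2 u)
    (heq : ∀ x, -lap u x = K * Real.exp (u x))
    (h0 : u 0 = 0) (h0' : fderiv ℝ u 0 = 0)
    (hint : Integrable (fun x => Real.exp (u x))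
      (volume : Measure (EuclideanSpace ℝ (Fin 2)))) :
    ∀ x, u x = -2 * Real.log (1 + (K / 8) * ‖x‖ ^ 2) := by
  have heq' (x : Plane) : pd 0 (pd 0 u) x + pd 1 (pd 1 u) x = -(K * Real.exp (u x)) := by
    rw [← lap_eq_pd hu, ← heq, neg_neg]
  exact eq_neg_two_log_of_hopf_eq_zero hu heq' (hopf_eq_zero hK hu heq' hint) h0
    (fun i => by simp [pd, h0'])
end

section
/- (Caffarelli–Gidas–Spruck classification) Let n ≥ 3 and let u be a positive C² solution of -Δu = u^{(n+2)/(n-2)} on ℝⁿ with u(0) = 1 and ∇u(0) = 0. Then there exists γ > 0 such that u(x) = (1 + γ|x|²)^{(2-n)/2}. -/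
open MeasureTheory Real

open Set Filter Topology InnerProductSpace Module Laplacian

section MovingSpheres

variable {E : Type*} [NormedAddCommGroup E] [InnerProductSpace ℝ E]

/-! ### Squared norms and orthonormal bases -/

lemma norm_sq_pos {F : Type*} [NormedAddCommGroup F] {y : F} (hy : y ≠ 0) : 0 < ‖y‖ ^ 2 := by
  have := norm_pos_iff.2 hy
  positivity

lemma sum_inner_sq {ι : Type*} [Fintype ι] (v : OrthonormalBasis ι ℝ E) (y : E) :
    ∑ i, inner ℝ (v i) y ^ 2 = ‖y‖ ^ 2 := by
  simpa using v.sum_sq_norm_inner_right y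

lemma sum_inner_mul_apply {ι : Type*} [Fintype ι] (v : OrthonormalBasis ι ℝ E) (y : E)
    (A : E →L[ℝ] ℝ) : ∑ i, inner ℝ (v i) y * A (v i) = A y := by
  conv_rhs => rw [← v.sum_repr' y]
  simp [map_sum]

lemma sum_inner_mul_apply_left {ι : Type*} [Fintype ι] (v : OrthonormalBasis ι ℝ E) (y z : E)
    (D : E →L[ℝ] E →L[ℝ] ℝ) : ∑ i, inner ℝ (v i) y * D (v i) z = D y z := by
  conv_rhs => rw [← v.sum_repr' y]
  simp [map_sum]

lemma hasDerivAt_norm_sq_line (y e : E) (he : ‖e‖ = 1) (t : ℝ) :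
    HasDerivAt (fun t : ℝ => ‖y + t • e‖ ^ 2) (2 * inner ℝ e y + 2 * t) t := by
  have h : (fun t : ℝ => ‖y + t • e‖ ^ 2) = fun t => ‖y‖ ^ 2 + 2 * inner ℝ e y * t + t ^ 2 := by
    ext t
    rw [norm_add_sq_real, inner_smul_right, norm_smul, he, real_inner_comm]
    simp
    ring
  rw [h]
  have := (((hasDerivAt_id t).const_mul (2 * inner ℝ e y)).const_add (‖y‖ ^ 2)).add
    ((hasDerivAt_id t).pow 2)
  refine this.congr_deriv ?_
  simp

/-! ### The Kelvin transform -/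

/-- The Kelvin transform of `u` with respect to the sphere of squared radius `τ`, in dimension
`2 b + 2`. -/
noncomputable def kelvin (b τ : ℝ) (u : E → ℝ) (y : E) : ℝ :=
  (τ / ‖y‖ ^ 2) ^ b * u ((τ / ‖y‖ ^ 2) • y)

lemma contDiffAt_kelvin (b : ℝ) {τ : ℝ} (hτ : 0 < τ) {u : E → ℝ} (hu : ContDiff ℝ 2 u) {y : E}
    (hy : y ≠ 0) : ContDiffAt ℝ 2 (kelvin b τ u) y := by
  have hρ := norm_sq_pos hy
  have h1 : ContDiffAt ℝ 2 (fun y : E => τ / ‖y‖ ^ 2) y :=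
    contDiffAt_const.div (contDiff_norm_sq ℝ).contDiffAt hρ.ne'
  exact (h1.rpow_const_of_ne (div_pos hτ hρ).ne').mul
    (hu.contDiffAt.comp y (h1.smul contDiffAt_id))

lemma kelvin_pos (b : ℝ) {τ : ℝ} (hτ : 0 < τ) {u : E → ℝ} (hu : ∀ x, 0 < u x) {y : E}
    (hy : y ≠ 0) : 0 < kelvin b τ u y :=
  mul_pos (rpow_pos_of_pos (div_pos hτ (norm_sq_pos hy)) _) (hu _)

lemma kelvin_of_norm_sq_eq (b : ℝ) {τ : ℝ} (hτ : 0 < τ) (u : E → ℝ) {y : E}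
    (hy : ‖y‖ ^ 2 = τ) : kelvin b τ u y = u y := by
  simp [kelvin, hy, div_self hτ.ne']

lemma norm_sq_inversion {τ : ℝ} {y : E} (hy : y ≠ 0) :
    ‖(τ / ‖y‖ ^ 2) • y‖ ^ 2 = τ ^ 2 / ‖y‖ ^ 2 := by
  have := norm_sq_pos hy
  rw [norm_smul, mul_pow, norm_eq_abs, sq_abs]
  field_simp

/-- If `u` agrees with its Kelvin transform outside a ball, it does so everywhere. -/
lemma kelvin_eq_of_forall_le {b τ : ℝ} (hτ : 0 < τ) {u : E → ℝ}
    (h : ∀ y : E, τ ≤ ‖y‖ ^ 2 → kelvin b τ u y = u y) {y : E} (hy : y ≠ 0) :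
    kelvin b τ u y = u y := by
  have hρ := norm_sq_pos hy
  by_cases hle : τ ≤ ‖y‖ ^ 2
  · exact h y hle
  · push Not at hle
    have hz := norm_sq_inversion (τ := τ) hy
    have h1 := h ((τ / ‖y‖ ^ 2) • y) (by rw [hz, le_div_iff₀ hρ]; nlinarith)
    have hinv : τ / (τ ^ 2 / ‖y‖ ^ 2) = ‖y‖ ^ 2 / τ := by field_simp
    have hone : ‖y‖ ^ 2 / τ * (τ / ‖y‖ ^ 2) = 1 := by field_simp
    unfold kelvin at h1 ⊢
    rw [hz, hinv, smul_smul, hone, one_smul] at h1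
    rw [← h1, ← mul_assoc, ← mul_rpow (by positivity) (by positivity), mul_comm (τ / ‖y‖ ^ 2),
      hone, one_rpow, one_mul]

lemma kelvin_le_mul {b τ T M : ℝ} (hτ : 0 < τ) (hτT : τ ≤ T) {u : E → ℝ}
    (hM : ∀ z : E, ‖z‖ ^ 2 ≤ T → u z ≤ M) {y : E} (hy : τ ≤ ‖y‖ ^ 2) :
    kelvin b τ u y ≤ (τ / ‖y‖ ^ 2) ^ b * M := by
  have hρ : 0 < ‖y‖ ^ 2 := hτ.trans_le hy
  have hy0 : y ≠ 0 := by rintro rfl; simp at hρ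
  refine mul_le_mul_of_nonneg_left (hM _ ?_) (by positivity)
  rw [norm_sq_inversion hy0, div_le_iff₀ hρ]
  nlinarith

lemma continuousAt_kelvin (b : ℝ) {u : E → ℝ} (hu : Continuous u) {τ : ℝ} (hτ : 0 < τ) {y : E}
    (hy : y ≠ 0) : ContinuousAt (fun q : ℝ × E => kelvin b q.1 u q.2) (τ, y) := by
  have hρ := norm_sq_pos hy
  have h1 : ContinuousAt (fun q : ℝ × E => q.1 / ‖q.2‖ ^ 2) (τ, y) :=
    ContinuousAt.div (by fun_prop) (by fun_prop) hρ.ne'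
  exact (h1.rpow_const (Or.inl (div_pos hτ hρ).ne')).mul
    (hu.continuousAt.comp (f := fun q : ℝ × E => (q.1 / ‖q.2‖ ^ 2) • q.2)
      (h1.smul continuousAt_snd))

lemma le_of_forall_kelvin_le {b : ℝ} {u : E → ℝ}
    (h : ∀ c : E, ∀ τ, 0 < τ → ∀ y : E, τ ≤ ‖y‖ ^ 2 →
      kelvin b τ (fun z => u (z + c)) y ≤ u (y + c)) (y z : E) : u z ≤ u y := by
  rcases eq_or_ne z y with rfl | hzy
  · rfl
  have hd : 0 < ‖z - y‖ := norm_sub_pos_iff.2 hzy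
  have hlim : Tendsto (fun s : ℝ => (1 - s⁻¹) ^ b * u z) atTop (𝓝 ((1 - 0) ^ b * u z)) :=
    ((tendsto_const_nhds.sub tendsto_inv_atTop_zero).rpow_const (by simp)).mul_const _
  rw [sub_zero, one_rpow, one_mul] at hlim
  refine le_of_tendsto hlim ?_
  filter_upwards [eventually_gt_atTop 1] with s hs
  have hs0 : 0 < s := by linarith
  have hs1 : 0 < s - 1 := by linarith
  have key := h (y + s • (z - y)) (s * (s - 1) * ‖z - y‖ ^ 2) (by positivity) (-s • (z - y)) (by
    rw [norm_smul, norm_neg, Real.norm_of_nonneg hs0.le, mul_pow]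
    gcongr
    nlinarith)
  have e1 : s * (s - 1) * ‖z - y‖ ^ 2 / ‖-s • (z - y)‖ ^ 2 = 1 - s⁻¹ := by
    rw [norm_smul, norm_neg, Real.norm_of_nonneg hs0.le, mul_pow]
    field_simp
  have e2 : (1 - s⁻¹) • -s • (z - y) + (y + s • (z - y)) = z := by
    have : (1 - s⁻¹) * -s = 1 - s := by field_simp; ring
    rw [smul_smul, this]
    module
  have e3 : -s • (z - y) + (y + s • (z - y)) = y := by module
  rwa [kelvin, e1, e2, e3] at key

lemma kelvin_transform_eq {b τ τ₀ : ℝ} (hτ : 0 < τ) (hτ₀ : 0 < τ₀) {u : E → ℝ} {x z : E}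
    (heq : ∀ y : E, y ≠ 0 → kelvin b τ (fun w => u (w + x)) y = u (y + x))
    (heq₀ : ∀ y : E, y ≠ 0 → kelvin b τ₀ u y = u y) (hz : z ≠ 0)
    (hD : 0 < 1 - 2 * ⟪z, x⟫_ℝ + ‖x‖ ^ 2 * ‖z‖ ^ 2) :
    (τ / (1 - 2 * ⟪z, x⟫_ℝ + ‖x‖ ^ 2 * ‖z‖ ^ 2)) ^ b *
      u ((τ / (1 - 2 * ⟪z, x⟫_ℝ + ‖x‖ ^ 2 * ‖z‖ ^ 2)) • (z - ‖z‖ ^ 2 • x) + x) =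
      τ₀ ^ b * u (τ₀ • z) := by
  have hρ := norm_sq_pos hz
  set ρ := ‖z‖ ^ 2 with hρdef
  set D := 1 - 2 * ⟪z, x⟫_ℝ + ‖x‖ ^ 2 * ρ with hDdef
  set w : E := ρ⁻¹ • z with hw
  have hw2 : ‖w‖ ^ 2 = ρ⁻¹ := by
    rw [hw, norm_smul, mul_pow, ← hρdef, Real.norm_of_nonneg (by positivity)]
    field_simp
  have hwx : ‖w - x‖ ^ 2 = D / ρ := by
    rw [norm_sub_sq_real, hw2, hw, real_inner_smul_left, hDdef]
    field_simp
  have hw0 : w ≠ 0 := smul_ne_zero (by positivity) hz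
  have hwx0 : w - x ≠ 0 := by
    intro h
    have : 0 < ‖w - x‖ ^ 2 := by rw [hwx]; positivity
    simp [h] at this
  have h1 := heq (w - x) hwx0
  have h2 := heq₀ w hw0
  rw [sub_add_cancel, ← h2, kelvin, kelvin, hwx, hw2] at h1
  have e1 : (τ / (D / ρ)) • (w - x) = (τ / D) • (z - ρ • x) := by
    rw [hw, smul_sub, smul_sub, smul_smul, smul_smul]
    congr 2 <;> field_simp
  have e2 : (τ₀ / ρ⁻¹) • w = τ₀ • z := by
    rw [hw, smul_smul]
    congr 1
    field_simp
  have e3 : (τ / (D / ρ)) ^ b = ρ ^ b * (τ / D) ^ b := by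
    rw [← mul_rpow hρ.le (by positivity)]
    congr 1
    field_simp
  have e4 : (τ₀ / ρ⁻¹) ^ b = ρ ^ b * τ₀ ^ b := by
    rw [← mul_rpow hρ.le hτ₀.le]
    congr 1
    field_simp
  rw [e1, e2, e3, e4, mul_assoc, mul_assoc] at h1
  exact mul_left_cancel₀ (rpow_pos_of_pos hρ b).ne' h1

/-- Comparing the expansions at infinity of the Kelvin transforms centred at `x` and at `0`. -/
lemma rpow_mul_eq_and_fderiv_eq {b τ τ₀ : ℝ} (hτ : 0 < τ) (hτ₀ : 0 < τ₀) {u : E → ℝ}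
    (hu : Differentiable ℝ u) {x e : E} (he : e ≠ 0)
    (heq : ∀ y : E, y ≠ 0 → kelvin b τ (fun w => u (w + x)) y = u (y + x))
    (heq₀ : ∀ y : E, y ≠ 0 → kelvin b τ₀ u y = u y) (hu' : fderiv ℝ u 0 = 0) :
    τ ^ b * u x = τ₀ ^ b * u 0 ∧ 2 * b * ⟪e, x⟫_ℝ * u x + τ * fderiv ℝ u x e = 0 := by
  set D : ℝ → ℝ := fun t => 1 - 2 * (t * ⟪e, x⟫_ℝ) + ‖x‖ ^ 2 * (t ^ 2 * ‖e‖ ^ 2) with hDdef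
  have hD0 : D 0 = 1 := by simp [hDdef]
  have hD : HasDerivAt D (-2 * ⟪e, x⟫_ℝ) 0 := by
    have h1 := (((hasDerivAt_id (0 : ℝ)).mul_const ⟪e, x⟫_ℝ).const_mul 2).const_sub 1
    have h2 := ((((hasDerivAt_id (0 : ℝ)).pow 2).mul_const (‖e‖ ^ 2)).const_mul (‖x‖ ^ 2))
    exact (h1.add h2).congr_deriv (by simp)
  have hq : HasDerivAt (fun t => τ / D t) (2 * τ * ⟪e, x⟫_ℝ) 0 :=
    ((hasDerivAt_const (0 : ℝ) τ).div hD (by simp [hD0])).congr_deriv (by simp [hD0]; ring)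
  have hqb : HasDerivAt (fun t => (τ / D t) ^ b) (2 * b * τ ^ b * ⟪e, x⟫_ℝ) 0 := by
    refine (hq.rpow_const (Or.inl (by simp [hD0, hτ.ne']))).congr_deriv ?_
    rw [hD0, div_one, rpow_sub_one hτ.ne']
    field_simp
  have hv : HasDerivAt (fun t : ℝ => t • e - (t ^ 2 * ‖e‖ ^ 2) • x) e 0 := by
    have h1 := (hasDerivAt_id (0 : ℝ)).smul_const e
    have h2 := (((hasDerivAt_id (0 : ℝ)).pow 2).mul_const (‖e‖ ^ 2)).smul_const x
    exact (h1.sub h2).congr_deriv (by simp)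
  have harg : HasDerivAt (fun t : ℝ => (τ / D t) • (t • e - (t ^ 2 * ‖e‖ ^ 2) • x) + x)
      (τ • e) 0 :=
    ((hq.smul hv).add_const x).congr_deriv (by simp [hD0])
  have hux : HasDerivAt (fun t : ℝ => u ((τ / D t) • (t • e - (t ^ 2 * ‖e‖ ^ 2) • x) + x))
      (fderiv ℝ u x (τ • e)) 0 :=
    HasFDerivAt.comp_hasDerivAt
      (f := fun t : ℝ => (τ / D t) • (t • e - (t ^ 2 * ‖e‖ ^ 2) • x) + x) 0
      (by simpa using (hu x).hasFDerivAt) harg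
  have hΦ := hqb.mul hux
  have hΨ : HasDerivAt (fun t : ℝ => τ₀ ^ b * u (τ₀ • t • e)) 0 0 := by
    have h1 : HasDerivAt (fun t : ℝ => τ₀ • t • e) (τ₀ • (1 : ℝ) • e) 0 :=
      ((hasDerivAt_id (0 : ℝ)).smul_const e).const_smul τ₀
    have h2 : HasDerivAt (fun t : ℝ => u (τ₀ • t • e)) (fderiv ℝ u 0 (τ₀ • (1 : ℝ) • e)) 0 :=
      HasFDerivAt.comp_hasDerivAt (f := fun t : ℝ => τ₀ • t • e) 0
        (by simpa using (hu 0).hasFDerivAt) h1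
    exact (h2.const_mul _).congr_deriv (by simp [hu'])
  have hev : ∀ᶠ t in 𝓝[≠] (0 : ℝ),
      (τ / D t) ^ b * u ((τ / D t) • (t • e - (t ^ 2 * ‖e‖ ^ 2) • x) + x) =
        τ₀ ^ b * u (τ₀ • t • e) := by
    have hpos : ∀ᶠ t in 𝓝[≠] (0 : ℝ), 0 < D t :=
      nhdsWithin_le_nhds (hD.continuousAt.eventually (lt_mem_nhds (by simp [hD0])))
    filter_upwards [hpos, self_mem_nhdsWithin] with t ht ht0
    have hn : ‖t • e‖ ^ 2 = t ^ 2 * ‖e‖ ^ 2 := by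
      rw [norm_smul, mul_pow, Real.norm_eq_abs, sq_abs]
    have := kelvin_transform_eq hτ hτ₀ heq heq₀ (smul_ne_zero ht0 he) (x := x)
    rw [real_inner_smul_left, hn] at this
    exact this ht
  have hval := tendsto_nhds_unique_of_eventuallyEq
    (hΦ.continuousAt.tendsto.mono_left nhdsWithin_le_nhds)
    (hΨ.continuousAt.tendsto.mono_left nhdsWithin_le_nhds) hev
  have hev' := eventuallyEq_nhdsWithin_iff.1 hev
  have hder := hΦ.unique (hΨ.congr_of_eventuallyEq
    (hev'.mono fun t ht => (eq_or_ne t 0).elim (fun h => by rw [h]; exact hval) ht))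
  simp only [Pi.mul_apply, hD0, div_one, zero_smul, ne_eq, OfNat.ofNat_ne_zero, not_false_eq_true,
    zero_pow, zero_mul, sub_zero, smul_zero, zero_add, map_smul, smul_eq_mul] at hval hder
  refine ⟨hval, ?_⟩
  refine mul_left_cancel₀ (rpow_pos_of_pos hτ b).ne' ?_
  rw [mul_zero, ← hder]
  ring

variable [FiniteDimensional ℝ E]

/-! ### Laplacians computed along lines -/

lemma laplacian_eq_sum_of_hasDerivAt {ι : Type*} [Fintype ι] (v : OrthonormalBasis ι ℝ E)
    {f : E → ℝ} {x : E} (hf : ContDiffAt ℝ 2 f x) (g : ι → ℝ → ℝ) (c : ι → ℝ)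
    (h1 : ∀ i, ∀ᶠ t in 𝓝 (0 : ℝ), HasDerivAt (fun t : ℝ => f (x + t • v i)) (g i t) t)
    (h2 : ∀ i, HasDerivAt (g i) (c i) 0) : Δ f x = ∑ i, c i := by
  rw [laplacian_eq_iteratedFDeriv_orthonormalBasis f v]
  refine Finset.sum_congr rfl fun i _ => ?_
  rw [iteratedFDeriv_two_apply]
  have hline : ∀ t : ℝ, HasDerivAt (fun t : ℝ => x + t • v i) (v i) t := fun t => by
    simpa using ((hasDerivAt_id t).smul_const (v i)).const_add x
  set D := fderiv ℝ (fderiv ℝ f) x with hD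
  have hd : HasFDerivAt (fderiv ℝ f) D (x + (0 : ℝ) • v i) := by
    have : ContDiffAt ℝ 1 (fderiv ℝ f) x := hf.fderiv_right (by norm_num)
    rw [zero_smul, add_zero]
    exact (this.differentiableAt (by norm_num)).hasFDerivAt
  have hev : ∀ᶠ t in 𝓝 (0 : ℝ), ContDiffAt ℝ 2 f (x + t • v i) := by
    have hc : ContinuousAt (fun t : ℝ => x + t • v i) 0 := (hline 0).continuousAt
    have := hf.eventually (by simp)
    apply hc.eventually
    simpa using this
  have heq : g i =ᶠ[𝓝 0] fun t => fderiv ℝ f (x + t • v i) (v i) := by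
    filter_upwards [hev, h1 i] with t ht ht1
    have := ((ht.differentiableAt (by norm_num)).hasFDerivAt).comp_hasDerivAt t (hline t)
    exact ht1.unique (f := fun t : ℝ => f (x + t • v i)) this
  have h3 : HasDerivAt (fun t : ℝ => fderiv ℝ f (x + t • v i) (v i))
      (D (v i) (v i)) 0 := by
    have hcomp : HasDerivAt (fun t : ℝ => fderiv ℝ f (x + t • v i)) (D (v i)) 0 :=
      HasFDerivAt.comp_hasDerivAt (f := fun t : ℝ => x + t • v i) (0 : ℝ) hd (hline 0)
    refine (hcomp.clm_apply (hasDerivAt_const (0 : ℝ) (v i))).congr_deriv ?_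
    rw [map_zero, add_zero]
  exact (h3.congr_of_eventuallyEq heq).unique (h2 i)

lemma deriv_deriv_nonneg_of_isLocalMin {g : ℝ → ℝ} {t : ℝ} (h : IsLocalMin g t)
    (hc : ContinuousAt g t) : 0 ≤ deriv (deriv g) t := by
  by_contra! hneg
  have hmax := isLocalMax_of_deriv_deriv_neg hneg h.deriv_eq_zero hc
  have : g =ᶠ[𝓝 t] fun _ => g t := by
    filter_upwards [h, hmax] with s h1 h2 using le_antisymm h2 h1
  have h2 := this.deriv.deriv_eq
  simp at h2
  linarith

lemma laplacian_nonneg_of_isLocalMin {f : E → ℝ} {x : E} (h : IsLocalMin f x)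
    (hf : ContDiffAt ℝ 2 f x) : 0 ≤ Δ f x := by
  set v := stdOrthonormalBasis ℝ E
  have hline : ∀ i, ∀ t : ℝ, HasDerivAt (fun t : ℝ => x + t • v i) (v i) t := fun i t => by
    simpa using ((hasDerivAt_id t).smul_const (v i)).const_add x
  have hdiff : ∀ i, ∀ᶠ t in 𝓝 (0 : ℝ), HasDerivAt (fun t : ℝ => f (x + t • v i))
      (deriv (fun t : ℝ => f (x + t • v i)) t) t := by
    intro i
    have hc : ContinuousAt (fun t : ℝ => x + t • v i) 0 := (hline i 0).continuousAt
    have hev : ∀ᶠ t in 𝓝 (0 : ℝ), ContDiffAt ℝ 2 f (x + t • v i) := by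
      have := hf.eventually (by simp)
      apply hc.eventually
      simpa using this
    filter_upwards [hev] with t ht
    exact (((ht.differentiableAt (by norm_num)).hasFDerivAt).comp_hasDerivAt t
      (hline i t)).differentiableAt.hasDerivAt
  have hd2 : ∀ i, HasDerivAt (deriv (fun t : ℝ => f (x + t • v i)))
      (deriv (deriv (fun t : ℝ => f (x + t • v i))) 0) 0 := by
    intro i
    have hcd : ContDiffAt ℝ 2 (fun t : ℝ => f (x + t • v i)) 0 := by
      have hf' : ContDiffAt ℝ 2 f (x + (0 : ℝ) • v i) := by simpa using hf
      exact hf'.comp (0 : ℝ) (by fun_prop)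
    have h1 : ContDiffAt ℝ 1 (deriv (fun t : ℝ => f (x + t • v i))) 0 :=
      hcd.derivWithin (m := 1) (by norm_num)
    exact (h1.differentiableAt (by norm_num)).hasDerivAt
  rw [laplacian_eq_sum_of_hasDerivAt v hf _ _ hdiff hd2]
  refine Finset.sum_nonneg fun i _ => deriv_deriv_nonneg_of_isLocalMin ?_ ?_
  · have hc : ContinuousAt (fun t : ℝ => x + t • v i) 0 := (hline i 0).continuousAt
    have : ∀ᶠ t in 𝓝 (0 : ℝ), f x ≤ f (x + t • v i) := by
      apply hc.eventually (p := fun z => f x ≤ f z)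
      simpa [IsLocalMin, IsMinFilter] using h
    simpa [IsLocalMin, IsMinFilter] using this
  · exact ((hdiff i).self_of_nhds).continuousAt

/-- The Laplacian of a power of the squared distance to a point. -/
lemma laplacian_norm_sq_rpow (s : ℝ) {c y : E} (hy : y ≠ c) :
    Δ (fun y : E => (‖y - c‖ ^ 2) ^ s) y =
      4 * s * (s + (finrank ℝ E : ℝ) / 2 - 1) * (‖y - c‖ ^ 2) ^ (s - 1) := by
  have hρ : 0 < ‖y - c‖ ^ 2 := by
    have := norm_pos_iff.2 (sub_ne_zero.2 hy)
    positivity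
  set v := stdOrthonormalBasis ℝ E
  have hq : ∀ i t, HasDerivAt (fun t : ℝ => ‖y + t • v i - c‖ ^ 2)
      (2 * inner ℝ (v i) (y - c) + 2 * t) t := fun i t => by
    simpa [add_sub_right_comm] using hasDerivAt_norm_sq_line (y - c) (v i) (by simp) t
  have hcd : ContDiffAt ℝ 2 (fun y : E => (‖y - c‖ ^ 2) ^ s) y :=
    ContDiffAt.rpow_const_of_ne ((contDiffAt_id.sub contDiffAt_const).norm_sq ℝ) hρ.ne'
  rw [laplacian_eq_sum_of_hasDerivAt v hcd
    (fun i t => (2 * inner ℝ (v i) (y - c) + 2 * t) * s * (‖y + t • v i - c‖ ^ 2) ^ (s - 1))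
    (fun i => 2 * s * (‖y - c‖ ^ 2) ^ (s - 1) +
      4 * s * (s - 1) * (‖y - c‖ ^ 2) ^ (s - 1 - 1) * inner ℝ (v i) (y - c) ^ 2)]
  · rw [Finset.sum_add_distrib, ← Finset.mul_sum Finset.univ (fun i => inner ℝ (v i) (y - c) ^ 2),
      sum_inner_sq]
    have : (‖y - c‖ ^ 2) ^ (s - 1) = (‖y - c‖ ^ 2) ^ (s - 1 - 1) * ‖y - c‖ ^ 2 := by
      rw [← rpow_add_one hρ.ne']; ring_nf
    rw [this]
    simp
    ring
  · intro i
    have : ContinuousAt (fun t : ℝ => ‖y + t • v i - c‖ ^ 2) 0 := (hq i 0).continuousAt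
    have h0 : ∀ᶠ t in 𝓝 (0 : ℝ), ‖y + t • v i - c‖ ^ 2 ≠ 0 := by
      apply this.eventually_ne
      simpa using hρ.ne'
    filter_upwards [h0] with t ht
    exact (hq i t).rpow_const (Or.inl ht)
  · intro i
    have h1 : HasDerivAt (fun t : ℝ => (2 * inner ℝ (v i) (y - c) + 2 * t) * s) (2 * s) 0 := by
      simpa using (((hasDerivAt_id (0 : ℝ)).const_mul 2).const_add
        (2 * inner ℝ (v i) (y - c))).mul_const s
    have h2 := h1.mul ((hq i 0).rpow_const (p := s - 1) (Or.inl (by simpa using hρ.ne')))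
    refine h2.congr_deriv ?_
    simp
    ring

lemma laplacian_kelvin {b : ℝ} (hb : 2 * b + 2 = finrank ℝ E) {τ : ℝ} (hτ : 0 < τ)
    {u : E → ℝ} (hu : ContDiff ℝ 2 u) {y : E} (hy : y ≠ 0) :
    Δ (kelvin b τ u) y = (τ / ‖y‖ ^ 2) ^ (b + 2) * Δ u ((τ / ‖y‖ ^ 2) • y) := by
  have hρ := norm_sq_pos hy
  set v := stdOrthonormalBasis ℝ E with hv
  set z := (τ / ‖y‖ ^ 2) • y with hz
  set r := τ / ‖y‖ ^ 2 with hr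
  have hrpos : 0 < r := div_pos hτ hρ
  set A := fderiv ℝ u z with hA
  set D := fderiv ℝ (fderiv ℝ u) z with hD
  let q : Fin (finrank ℝ E) → ℝ → ℝ := fun i t => ‖y + t • v i‖ ^ 2
  let q' : Fin (finrank ℝ E) → ℝ → ℝ := fun i t => 2 * inner ℝ (v i) y + 2 * t
  let R : Fin (finrank ℝ E) → ℝ → ℝ := fun i t => τ / q i t
  let R' : Fin (finrank ℝ E) → ℝ → ℝ := fun i t => -(τ * q' i t) / q i t ^ 2
  let R'' : Fin (finrank ℝ E) → ℝ := fun i =>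
    -2 * τ / (‖y‖ ^ 2) ^ 2 + 8 * inner ℝ (v i) y ^ 2 * τ / (‖y‖ ^ 2) ^ 3
  let γ : Fin (finrank ℝ E) → ℝ → E := fun i t => R i t • (y + t • v i)
  let γ' : Fin (finrank ℝ E) → ℝ → E := fun i t => R i t • v i + R' i t • (y + t • v i)
  let γ'' : Fin (finrank ℝ E) → E := fun i => (2 * R' i 0) • v i + R'' i • y
  have hline : ∀ i, ∀ t : ℝ, HasDerivAt (fun t : ℝ => y + t • v i) (v i) t := fun i t => by
    simpa using ((hasDerivAt_id t).smul_const (v i)).const_add y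
  have hq : ∀ i t, HasDerivAt (q i) (q' i t) t := fun i t =>
    hasDerivAt_norm_sq_line y (v i) (by simp [hv]) t
  have hq0 : ∀ i, q i 0 = ‖y‖ ^ 2 := fun i => by simp [q]
  have hR0 : ∀ i, R i 0 = r := fun i => by simp [R, hq0, hr]
  have hγ0 : ∀ i, γ i 0 = z := fun i => by simp [γ, hR0, hz]
  have hqne : ∀ i, ∀ᶠ t in 𝓝 (0 : ℝ), q i t ≠ 0 := fun i => by
    apply (hq i 0).continuousAt.eventually_ne
    rw [hq0]; exact hρ.ne'
  have hR : ∀ i t, q i t ≠ 0 → HasDerivAt (R i) (R' i t) t := fun i t ht => by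
    refine ((hasDerivAt_const t τ).div (hq i t) ht).congr_deriv ?_
    simp [R']
  have hγ : ∀ i t, q i t ≠ 0 → HasDerivAt (γ i) (γ' i t) t := fun i t ht =>
    (hR i t ht).smul (hline i t)
  have hR' : ∀ i, HasDerivAt (R' i) (R'' i) 0 := fun i => by
    have h1 : HasDerivAt (q' i) 2 0 := by
      refine (((hasDerivAt_id (0 : ℝ)).const_mul 2).const_add (2 * inner ℝ (v i) y)).congr_deriv ?_
      simp
    have h2 := ((h1.const_mul τ).neg).div ((hq i 0).pow 2)
      (by simpa [hq0] using hy)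
    refine h2.congr_deriv ?_
    simp only [R'', q', Pi.pow_apply, Pi.neg_apply, hq0]
    field_simp
    ring
  have hγ' : ∀ i, HasDerivAt (γ' i) (γ'' i) 0 := fun i => by
    have h1 := ((hR i 0 (by rw [hq0]; exact hρ.ne')).smul_const (v i)).add
      ((hR' i).smul (hline i 0))
    refine h1.congr_deriv ?_
    simp only [γ'', zero_smul, add_zero]
    module
  have hud : ∀ x, HasFDerivAt u (fderiv ℝ u x) x := fun x =>
    (hu.differentiable (by norm_num) x).hasFDerivAt
  have hud2 : ∀ x, HasFDerivAt (fderiv ℝ u) (fderiv ℝ (fderiv ℝ u) x) x := fun x =>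
    ((hu.fderiv_right (m := 1) (by norm_num)).differentiable (by norm_num) x).hasFDerivAt
  rw [laplacian_eq_sum_of_hasDerivAt v (contDiffAt_kelvin b hτ hu hy)
    (fun i t => (R' i t * b * R i t ^ (b - 1)) * u (γ i t) +
      R i t ^ b * fderiv ℝ u (γ i t) (γ' i t))
    (fun i => (((R'' i * b) * r ^ (b - 1) + R' i 0 * b * (R' i 0 * (b - 1) * r ^ (b - 1 - 1))) * u z
      + (R' i 0 * b * r ^ (b - 1)) * A (γ' i 0)) + ((R' i 0 * b * r ^ (b - 1)) * A (γ' i 0) +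
        r ^ b * (D (γ' i 0) (γ' i 0) + A (γ'' i))))]
  · have hΔ : Δ u z = ∑ i, D (v i) (v i) := by
      rw [laplacian_eq_iteratedFDeriv_orthonormalBasis u v]
      simp [iteratedFDeriv_two_apply, hD]
    have e1 := sum_inner_sq v y
    have e2 := sum_inner_mul_apply v y A
    have e3 := sum_inner_mul_apply_left v y y D
    have e4 := sum_inner_mul_apply v y (D y)
    have hρτ : ‖y‖ ^ 2 = τ / r := by rw [hr]; field_simp
    have p1 : r ^ (b - 1) = r ^ (b - 2) * r := by
      rw [← rpow_add_one hrpos.ne']; ring_nf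
    have p0 : r ^ b = r ^ (b - 2) * r ^ 2 := by
      rw [← rpow_natCast, ← rpow_add hrpos]; norm_num
    have p2 : r ^ (b + 2) = r ^ (b - 2) * r ^ 4 := by
      rw [← rpow_natCast, ← rpow_add hrpos]; norm_num; ring_nf
    have p3 : r ^ (b - 1 - 1) = r ^ (b - 2) := by ring_nf
    rw [p2, hΔ]
    calc _ = ∑ i, (r ^ (b - 2) * (-2 * b * r ^ 3 / τ) * u z
          + r ^ (b - 2) * (8 * b * r ^ 4 / τ ^ 2 + 4 * b * (b - 1) * r ^ 4 / τ ^ 2) * u z *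
              inner ℝ (v i) y ^ 2
          + r ^ (b - 2) * (8 * b + 8) * r ^ 5 / τ ^ 2 * A y * inner ℝ (v i) y ^ 2
          - r ^ (b - 2) * 2 * r ^ 4 / τ * A y
          - r ^ (b - 2) * (4 * b + 4) * r ^ 4 / τ * (inner ℝ (v i) y * A (v i))
          + r ^ (b - 2) * r ^ 4 * D (v i) (v i)
          - r ^ (b - 2) * 2 * r ^ 5 / τ * (inner ℝ (v i) y * D (v i) y)
          - r ^ (b - 2) * 2 * r ^ 5 / τ * (inner ℝ (v i) y * D y (v i))
          + r ^ (b - 2) * 4 * r ^ 6 / τ ^ 2 * D y y * inner ℝ (v i) y ^ 2) := by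
            refine Finset.sum_congr rfl fun i _ => ?_
            simp only [γ', γ'', R', R'', q', hR0, hq0, p0, p1, p3, hρτ, map_add, map_smul,
              _root_.add_apply, _root_.smul_apply, smul_eq_mul,
              zero_smul, add_zero, mul_zero]
            field_simp
            ring
      _ = _ := by
            simp only [Finset.sum_add_distrib, Finset.sum_sub_distrib, ← Finset.mul_sum, e1, e2,
              e3, e4, Finset.sum_const, Finset.card_univ, Fintype.card_fin, nsmul_eq_mul, ← hb,
              hρτ]
            field_simp
            ring
  · intro i
    filter_upwards [hqne i] with t ht
    have hqpos : 0 < q i t := lt_of_le_of_ne (by positivity) ht.symm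
    have hRpos : R i t ≠ 0 := (div_pos hτ hqpos).ne'
    exact ((hR i t ht).rpow_const (Or.inl hRpos)).mul
      ((hud (γ i t)).comp_hasDerivAt t (hγ i t ht))
  · intro i
    have hne : q i 0 ≠ 0 := by rw [hq0]; exact hρ.ne'
    have hRne : R i 0 ≠ 0 := by rw [hR0]; exact hrpos.ne'
    have k1 := ((hR' i).mul_const b).mul ((hR i 0 hne).rpow_const (p := b - 1) (Or.inl hRne))
    have k2 := k1.mul ((hud (γ i 0)).comp_hasDerivAt 0 (hγ i 0 hne))
    have k3 := ((hud2 (γ i 0)).comp_hasDerivAt 0 (hγ i 0 hne)).clm_apply (hγ' i)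
    have k4 := k2.add (((hR i 0 hne).rpow_const (p := b) (Or.inl hRne)).mul k3)
    refine k4.congr_deriv ?_
    simp only [Function.comp_apply, Pi.mul_apply, hR0, hγ0, ← hA, ← hD]

/-! ### Maximum principles -/

/-- A maximum principle relative to a positive comparison function `h`: a function which is a
strict supersolution relative to `h` wherever it is negative is nonnegative. -/
lemma nonneg_of_laplacian_lt {S : Set E} (hS : IsClosed S) {w h : E → ℝ}
    (hw : ContinuousOn w S) (hh : ContinuousOn h S) (hpos : ∀ y ∈ S, 0 < h y)
    (hdecay : ∀ ε > 0, ∃ R : ℝ, ∀ y ∈ S, R < ‖y‖ → -ε * h y ≤ w y)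
    (hlap : ∀ y ∈ S, w y < 0 → S ∈ 𝓝 y ∧ ContDiffAt ℝ 2 w y ∧ ContDiffAt ℝ 2 h y ∧
      Δ w y < w y / h y * Δ h y) : ∀ y ∈ S, 0 ≤ w y := by
  by_contra! hcon
  obtain ⟨y₁, hy₁, hneg⟩ := hcon
  have hq : w y₁ / h y₁ < 0 := div_neg_of_neg_of_pos hneg (hpos y₁ hy₁)
  obtain ⟨R, hR⟩ := hdecay (-(w y₁ / h y₁) / 2) (by linarith)
  have hK : IsCompact (S ∩ Metric.closedBall (0 : E) (max R ‖y₁‖)) :=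
    (isCompact_closedBall _ _).inter_left hS
  obtain ⟨y₀, hy₀, hmin⟩ := hK.exists_isMinOn (f := fun y => w y / h y)
    ⟨y₁, hy₁, by simp⟩
    ((hw.mono inter_subset_left).div (hh.mono inter_subset_left)
      fun y hy => (hpos y hy.1).ne')
  have hm₁ : w y₀ / h y₀ ≤ w y₁ / h y₁ := hmin ⟨hy₁, by simp⟩
  have hall : ∀ y ∈ S, w y₀ / h y₀ ≤ w y / h y := by
    intro y hy
    by_cases hyR : ‖y‖ ≤ max R ‖y₁‖
    · exact hmin ⟨hy, by simpa using hyR⟩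
    · have h1 := hR y hy (lt_of_le_of_lt (le_max_left _ _) (not_le.1 hyR))
      have h2 : w y₁ / h y₁ / 2 ≤ w y / h y := by
        rw [le_div_iff₀ (hpos y hy)]
        linarith
      linarith
  have hh₀ := hpos y₀ hy₀.1
  have hw₀ : w y₀ < 0 := by
    have : w y₀ / h y₀ < 0 := by linarith
    rwa [div_lt_iff₀ hh₀, zero_mul] at this
  obtain ⟨hnhds, hcw, hch, hΔ⟩ := hlap y₀ hy₀.1 hw₀
  have hlm : IsLocalMin (w - (w y₀ / h y₀) • h) y₀ := by
    filter_upwards [hnhds] with y hy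
    have h1 := hall y hy
    rw [le_div_iff₀ (hpos y hy)] at h1
    simp only [Pi.sub_apply, Pi.smul_apply, smul_eq_mul, div_mul_cancel₀ _ hh₀.ne']
    linarith
  have hsm : ContDiffAt ℝ 2 ((w y₀ / h y₀) • h) y₀ := hch.const_smul (w y₀ / h y₀)
  have := laplacian_nonneg_of_isLocalMin hlm (hcw.sub hsm)
  rw [hcw.laplacian_sub hsm, laplacian_smul _ hch, smul_eq_mul] at this
  linarith

lemma pos_on_ball_of_laplacian_nonpos [Nontrivial E] {w : E → ℝ} {c : E} {R : ℝ} (hR : 0 < R)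
    (hcd : ∀ y ∈ Metric.closedBall c R, ContDiffAt ℝ 2 w y)
    (hw : ∀ y ∈ Metric.closedBall c R, 0 ≤ w y)
    (hΔ : ∀ y ∈ Metric.closedBall c R, Δ w y ≤ 0) (hc : 0 < w c) :
    ∀ y ∈ Metric.ball c R, 0 < w y := by
  have hn : (0 : ℝ) < finrank ℝ E := by exact_mod_cast finrank_pos
  set s : ℝ := -(finrank ℝ E : ℝ) / 2 with hs
  have hs0 : s < 0 := by rw [hs]; linarith
  obtain ⟨r, hr, hrw⟩ : ∃ r > 0, ∀ y, ‖y - c‖ < r → w c / 2 < w y := by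
    have h1 : ∀ᶠ y in 𝓝 c, w c / 2 < w y :=
      (hcd c (by simpa using hR.le)).continuousAt.eventually_const_lt (by linarith)
    obtain ⟨r, hr, h2⟩ := Metric.eventually_nhds_iff.1 h1
    exact ⟨r, hr, fun y hy => h2 (by rwa [dist_eq_norm])⟩
  set r₀ := min (r / 2) (R / 2) with hr₀
  have hr₀pos : 0 < r₀ := by positivity
  have hr₀r : r₀ < r := lt_of_le_of_lt (min_le_left _ _) (by linarith)
  set g : E → ℝ := fun y => (‖y - c‖ ^ 2) ^ s with hg
  have hgr : 0 < (r₀ ^ 2) ^ s := by positivity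
  set ε := w c / 2 / (r₀ ^ 2) ^ s with hε
  have hεpos : 0 < ε := by positivity
  have hεr : ε * (r₀ ^ 2) ^ s = w c / 2 := by rw [hε]; field_simp
  have hCR : 0 < (R ^ 2) ^ s := by positivity
  set S : Set E := {y | r₀ ≤ ‖y - c‖ ∧ ‖y - c‖ ≤ R} with hSdef
  have hnc : Continuous fun y : E => ‖y - c‖ := by fun_prop
  have hSc : IsClosed S :=
    (isClosed_le continuous_const hnc).inter (isClosed_le hnc continuous_const)
  have hSne : ∀ y ∈ S, y ≠ c := by
    rintro y ⟨h1, -⟩ rfl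
    simp at h1; linarith
  have hSball : ∀ y ∈ S, y ∈ Metric.closedBall c R := fun y hy => by
    rw [Metric.mem_closedBall, dist_eq_norm]; exact hy.2
  have hgc : ∀ y ∈ S, ContDiffAt ℝ 2 g y := fun y hy =>
    ContDiffAt.rpow_const_of_ne ((contDiffAt_id.sub contDiffAt_const).norm_sq ℝ)
      (norm_sq_pos (sub_ne_zero.2 (hSne y hy))).ne'
  have hw'c : ∀ y ∈ S, ContDiffAt ℝ 2 (w - ε • g + fun _ => ε * (R ^ 2) ^ s) y := fun y hy =>
    ((hcd y (hSball y hy)).sub ((hgc y hy).const_smul ε)).add contDiffAt_const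
  have key := nonneg_of_laplacian_lt hSc (w := w - ε • g + fun _ => ε * (R ^ 2) ^ s)
    (h := fun _ => 1) (fun y hy => (hw'c y hy).continuousAt.continuousWithinAt)
    continuousOn_const (fun _ _ => one_pos)
    (fun ε _ => ⟨R + ‖c‖, fun y hy hyR => by
      have := norm_sub_norm_le y c
      have := hy.2
      linarith⟩) ?_
  · intro y hy
    rw [Metric.mem_ball, dist_eq_norm] at hy
    by_cases hyr : ‖y - c‖ < r₀
    · have := hrw y (hyr.trans hr₀r)
      linarith
    · push Not at hyr
      have h1 := key y ⟨hyr, hy.le⟩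
      simp only [Pi.add_apply, Pi.sub_apply, Pi.smul_apply, smul_eq_mul, hg] at h1
      have h2 : (R ^ 2) ^ s < (‖y - c‖ ^ 2) ^ s :=
        rpow_lt_rpow_of_neg (pow_pos (hr₀pos.trans_le hyr) 2)
          (pow_lt_pow_left₀ hy (norm_nonneg _) two_ne_zero) hs0
      nlinarith
  · intro y hy hneg
    simp only [Pi.add_apply, Pi.sub_apply, Pi.smul_apply, smul_eq_mul, hg] at hneg
    have hy1 : r₀ < ‖y - c‖ := by
      refine lt_of_le_of_ne hy.1 fun heq => ?_
      rw [← heq, hεr] at hneg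
      have := hrw y (by rw [← heq]; exact hr₀r)
      have := mul_pos hεpos hCR
      linarith
    have hy2 : ‖y - c‖ < R := by
      refine lt_of_le_of_ne hy.2 fun heq => ?_
      rw [heq] at hneg
      have := hw y (hSball y hy)
      linarith
    refine ⟨?_, hw'c y hy, contDiffAt_const, ?_⟩
    · have ho : IsOpen {y : E | r₀ < ‖y - c‖ ∧ ‖y - c‖ < R} :=
        (isOpen_lt continuous_const hnc).inter (isOpen_lt hnc continuous_const)
      exact mem_of_superset (ho.mem_nhds ⟨hy1, hy2⟩) fun z hz => ⟨hz.1.le, hz.2.le⟩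
    · have hcw := hcd y (hSball y hy)
      have hsm : ContDiffAt ℝ 2 (ε • g) y := (hgc y hy).const_smul ε
      have hc1 : Δ (fun _ : E => (1 : ℝ)) y = 0 := by simp
      have hc2 : Δ (fun _ : E => ε * (R ^ 2) ^ s) y = 0 := by simp
      have hgΔ : 0 < Δ g y := by
        rw [hg, laplacian_norm_sq_rpow s (hSne y hy)]
        have : 0 < (‖y - c‖ ^ 2) ^ (s - 1) := by
          have := norm_sq_pos (sub_ne_zero.2 (hSne y hy))
          positivity
        have h4 : 4 * s * (s + (finrank ℝ E : ℝ) / 2 - 1) = 2 * finrank ℝ E := by rw [hs]; ring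
        rw [h4]
        positivity
      have hsub : ContDiffAt ℝ 2 (w - ε • g) y := hcw.sub hsm
      rw [hsub.laplacian_add contDiffAt_const, hcw.laplacian_sub hsm,
        laplacian_smul _ (hgc y hy), hc1, hc2, smul_eq_mul]
      have := hΔ y (hSball y hy)
      nlinarith [mul_pos hεpos hgΔ]

/-- The strong maximum principle. -/
lemma eqOn_zero_or_pos_of_laplacian_nonpos [Nontrivial E] {A : Set E} (hA : IsOpen A)
    (hAc : IsPreconnected A) {w : E → ℝ} (hcd : ∀ y ∈ A, ContDiffAt ℝ 2 w y)
    (hw : ∀ y ∈ A, 0 ≤ w y) (hΔ : ∀ y ∈ A, Δ w y ≤ 0) :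
    (∀ y ∈ A, w y = 0) ∨ ∀ y ∈ A, 0 < w y := by
  have hU : IsOpen {y | y ∈ A ∧ 0 < w y} := by
    rw [isOpen_iff_mem_nhds]
    rintro y ⟨hy, hpos⟩
    exact inter_mem (hA.mem_nhds hy) ((hcd y hy).continuousAt.eventually_const_lt hpos)
  have hV : IsOpen {y | y ∈ A ∧ w y = 0} := by
    rw [Metric.isOpen_iff]
    rintro y₀ ⟨hy₀, h0⟩
    obtain ⟨r, hr, hrA⟩ := Metric.isOpen_iff.1 hA y₀ hy₀
    refine ⟨r / 2, by positivity, fun y₁ hy₁ => ?_⟩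
    rw [Metric.mem_ball] at hy₁
    have hsub : Metric.closedBall y₁ (r / 2) ⊆ A := fun z hz => hrA (by
      rw [Metric.mem_closedBall] at hz
      rw [Metric.mem_ball]
      have := dist_triangle z y₁ y₀
      linarith)
    have hy₁A : y₁ ∈ A := hsub (Metric.mem_closedBall_self (by positivity))
    refine ⟨hy₁A, ?_⟩
    by_contra hne
    have hpos : 0 < w y₁ := lt_of_le_of_ne (hw y₁ hy₁A) (Ne.symm hne)
    have := pos_on_ball_of_laplacian_nonpos (by positivity) (fun y hy => hcd y (hsub hy))
      (fun y hy => hw y (hsub hy)) (fun y hy => hΔ y (hsub hy)) hpos y₀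
      (by rw [Metric.mem_ball, dist_comm]; exact hy₁)
    linarith
  have hdisj : Disjoint {y | y ∈ A ∧ w y = 0} {y | y ∈ A ∧ 0 < w y} := by
    rw [Set.disjoint_left]
    rintro y ⟨-, h1⟩ ⟨-, h2⟩
    linarith
  rcases hAc.subset_or_subset hV hU hdisj (fun y hy => by
    rcases (hw y hy).eq_or_lt with h | h
    · exact Or.inl ⟨hy, h.symm⟩
    · exact Or.inr ⟨hy, h⟩) with h | h
  · exact Or.inl fun y hy => (h hy).2
  · exact Or.inr fun y hy => (h hy).2

lemma isPreconnected_setOf_lt_norm_sq (hE : 1 < finrank ℝ E) {τ : ℝ} (hτ : 0 < τ) :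
    IsPreconnected {y : E | τ < ‖y‖ ^ 2} := by
  have hrank : 1 < Module.rank ℝ E := by
    rw [← finrank_eq_rank]; exact_mod_cast hE
  have himg : {y : E | τ < ‖y‖ ^ 2} =
      (fun p : ℝ × E => p.1 • p.2) '' (Ioi √τ ×ˢ Metric.sphere (0 : E) 1) := by
    ext y
    simp only [mem_ofPred_eq, mem_image, mem_prod, mem_Ioi, mem_sphere_iff_norm, sub_zero,
      Prod.exists]
    constructor
    · intro hy
      have hpos : 0 < ‖y‖ := by
        by_contra! h
        have : ‖y‖ = 0 := le_antisymm h (norm_nonneg _)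
        rw [this] at hy; norm_num at hy; linarith
      refine ⟨‖y‖, ‖y‖⁻¹ • y, ⟨(Real.sqrt_lt' hpos).2 hy, ?_⟩, ?_⟩
      · rw [norm_smul, norm_inv, norm_norm, inv_mul_cancel₀ hpos.ne']
      · rw [smul_smul, mul_inv_cancel₀ hpos.ne', one_smul]
    · rintro ⟨r, x, ⟨hr, hx⟩, rfl⟩
      have hrpos : 0 < r := (Real.sqrt_pos.2 hτ).trans hr
      rw [norm_smul, hx, mul_one, norm_eq_abs, sq_abs]
      exact (Real.sqrt_lt' hrpos).1 hr
  rw [himg]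
  exact (isPreconnected_Ioi.prod (isPreconnected_sphere hrank 0 1)).image _
    (by fun_prop)

/-! ### Moving spheres -/

/-- Positive `C²` solutions of the critical equation `-Δu = u^{(n+2)/(n-2)}` on the whole space,
in dimension `n = 2 b + 2`. -/
structure IsCriticalSolution (b : ℝ) (u : E → ℝ) : Prop where
  contDiff : ContDiff ℝ 2 u
  pos : ∀ x, 0 < u x
  laplacian_eq : ∀ x, Δ u x = -u x ^ (1 + 2 / b)

lemma IsCriticalSolution.comp_add_right {b : ℝ} {u : E → ℝ} (hu : IsCriticalSolution b u)
    (c : E) : IsCriticalSolution b fun y => u (y + c) where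
  contDiff := hu.contDiff.comp (contDiff_id.add contDiff_const)
  pos y := hu.pos _
  laplacian_eq y := by
    rw [← hu.laplacian_eq (y + c), laplacian_eq_iteratedFDeriv_stdOrthonormalBasis,
      laplacian_eq_iteratedFDeriv_stdOrthonormalBasis]
    simp only [iteratedFDeriv_comp_add_right]

lemma rpow_sub_rpow_le {a c p : ℝ} (ha : 0 < a) (hc : 0 < c) (hp : 1 ≤ p) :
    c ^ p - a ^ p ≤ p * c ^ (p - 1) * (c - a) := by
  have h1 := one_add_mul_self_le_rpow_one_add (s := a / c - 1)
    (by have := div_pos ha hc; linarith) hp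
  rw [add_sub_cancel, div_rpow ha.le hc.le, le_div_iff₀ (by positivity)] at h1
  have h2 : c ^ p = c ^ (p - 1) * c := by rw [← rpow_add_one hc.ne']; ring_nf
  have h3 : (1 + p * (a / c - 1)) * c ^ p = c ^ p + p * c ^ (p - 1) * (a - c) := by
    rw [h2]; field_simp
  rw [h3] at h1
  linarith

namespace IsCriticalSolution

variable {b : ℝ} {u : E → ℝ}

lemma laplacian_kelvin_eq (hu : IsCriticalSolution b u) (hb0 : 0 < b)
    (hb : 2 * b + 2 = finrank ℝ E) {τ : ℝ} (hτ : 0 < τ) {y : E} (hy : y ≠ 0) :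
    Δ (kelvin b τ u) y = -kelvin b τ u y ^ (1 + 2 / b) := by
  have hr : 0 < τ / ‖y‖ ^ 2 := div_pos hτ (norm_sq_pos hy)
  rw [laplacian_kelvin hb hτ hu.contDiff hy, hu.laplacian_eq, kelvin,
    mul_rpow (by positivity) (hu.pos _).le, ← rpow_mul hr.le]
  have : b * (1 + 2 / b) = b + 2 := by field_simp
  rw [this]
  ring

lemma contDiffAt_sub_kelvin (hu : IsCriticalSolution b u) {τ : ℝ} (hτ : 0 < τ) {y : E}
    (hy : y ≠ 0) : ContDiffAt ℝ 2 (u - kelvin b τ u) y :=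
  hu.contDiff.contDiffAt.sub (contDiffAt_kelvin b hτ hu.contDiff hy)

lemma laplacian_sub_kelvin (hu : IsCriticalSolution b u) (hb0 : 0 < b)
    (hb : 2 * b + 2 = finrank ℝ E) {τ : ℝ} (hτ : 0 < τ) {y : E} (hy : y ≠ 0) :
    Δ (u - kelvin b τ u) y = kelvin b τ u y ^ (1 + 2 / b) - u y ^ (1 + 2 / b) := by
  rw [hu.contDiff.contDiffAt.laplacian_sub (contDiffAt_kelvin b hτ hu.contDiff hy),
    hu.laplacian_eq, hu.laplacian_kelvin_eq hb0 hb hτ hy]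
  ring

lemma laplacian_sub_kelvin_le (hu : IsCriticalSolution b u) (hb0 : 0 < b)
    (hb : 2 * b + 2 = finrank ℝ E) {τ T M : ℝ} (hτ : 0 < τ) (hτT : τ ≤ T)
    (hM : ∀ z : E, ‖z‖ ^ 2 ≤ T → u z ≤ M) {y : E} (hy : τ ≤ ‖y‖ ^ 2)
    (hneg : (u - kelvin b τ u) y < 0) :
    Δ (u - kelvin b τ u) y ≤
      (1 + 2 / b) * M ^ (2 / b) * (τ / ‖y‖ ^ 2) ^ 2 * -(u - kelvin b τ u) y := by
  have hρ : 0 < ‖y‖ ^ 2 := hτ.trans_le hy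
  have hy0 : y ≠ 0 := by rintro rfl; simp at hρ
  have hM0 : 0 < M := (hu.pos 0).trans_le (hM 0 (by simp; linarith))
  have hk := kelvin_pos b hτ hu.pos hy0
  have hp : 0 < 2 / b := by positivity
  rw [hu.laplacian_sub_kelvin hb0 hb hτ hy0]
  refine (rpow_sub_rpow_le (hu.pos y) hk (by linarith)).trans ?_
  have h1 : kelvin b τ u y ^ (1 + 2 / b - 1) ≤ M ^ (2 / b) * (τ / ‖y‖ ^ 2) ^ 2 := by
    rw [add_sub_cancel_left]
    refine (rpow_le_rpow hk.le (kelvin_le_mul hτ hτT hM hy) hp.le).trans_eq ?_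
    rw [mul_rpow (by positivity) hM0.le, ← rpow_mul (by positivity), mul_comm,
      mul_div_cancel₀ _ hb0.ne', rpow_two]
  have h2 : kelvin b τ u y - u y = -(u - kelvin b τ u) y := by simp
  rw [h2]
  have h3 : 0 ≤ -(u - kelvin b τ u) y := by linarith
  calc _ ≤ (1 + 2 / b) * (M ^ (2 / b) * (τ / ‖y‖ ^ 2) ^ 2) * -(u - kelvin b τ u) y := by gcongr
    _ = _ := by ring

lemma kelvin_le_of_large (hu : IsCriticalSolution b u) (hb0 : 0 < b)
    (hb : 2 * b + 2 = finrank ℝ E) {τ T M R : ℝ} (hτ : 0 < τ) (hτT : τ ≤ T)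
    (hM : ∀ z : E, ‖z‖ ^ 2 ≤ T → u z ≤ M) (hτR : τ ≤ R)
    (hR : (1 + 2 / b) * M ^ (2 / b) * τ ^ 2 < b ^ 2 * R)
    (hbd : ∀ y : E, ‖y‖ ^ 2 = R → kelvin b τ u y ≤ u y) :
    ∀ y : E, R ≤ ‖y‖ ^ 2 → kelvin b τ u y ≤ u y := by
  set S : Set E := {y | R ≤ ‖y‖ ^ 2} with hS
  have hns : Continuous fun y : E => ‖y‖ ^ 2 := by fun_prop
  have hpos : ∀ y ∈ S, 0 < ‖y‖ ^ 2 := fun y hy => (hτ.trans_le hτR).trans_le hy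
  have hne : ∀ y ∈ S, y ≠ 0 := by
    rintro y hy rfl
    simpa using hpos _ hy
  have hM0 : 0 < M := (hu.pos 0).trans_le (hM 0 (by simp; linarith))
  have hh : ∀ y ∈ S, ContDiffAt ℝ 2 (fun y : E => (‖y‖ ^ 2) ^ (-b / 2)) y := fun y hy =>
    ContDiffAt.rpow_const_of_ne (contDiff_norm_sq ℝ).contDiffAt (hpos y hy).ne'
  have hw : ∀ y ∈ S, ContDiffAt ℝ 2 (u - kelvin b τ u) y := fun y hy =>
    hu.contDiffAt_sub_kelvin hτ (hne y hy)
  have key := nonneg_of_laplacian_lt (isClosed_le continuous_const hns : IsClosed S)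
    (fun y hy => (hw y hy).continuousAt.continuousWithinAt)
    (fun y hy => (hh y hy).continuousAt.continuousWithinAt)
    (fun y hy => rpow_pos_of_pos (hpos y hy) _) ?_ ?_
  · intro y hy
    have := key y hy
    simpa using this
  · intro ε hε
    obtain ⟨R', hR'⟩ := eventually_atTop.1
      ((tendsto_rpow_atTop hb0).eventually_ge_atTop (τ ^ b * M / ε))
    refine ⟨R', fun y hy hyR => ?_⟩
    have h1 := hR' ‖y‖ hyR.le
    have hy0 : 0 < ‖y‖ := norm_pos_iff.2 (hne y hy)
    have hN : 0 < ‖y‖ ^ b := by positivity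
    have e1 : (‖y‖ ^ 2) ^ (-b / 2) = (‖y‖ ^ b)⁻¹ := by
      rw [← rpow_two, ← rpow_mul hy0.le, ← rpow_neg hy0.le]; ring_nf
    have e2 : (τ / ‖y‖ ^ 2) ^ b = τ ^ b / (‖y‖ ^ b) ^ 2 := by
      rw [div_rpow hτ.le (by positivity), ← rpow_two, ← rpow_two, ← rpow_mul hy0.le,
        ← rpow_mul hy0.le, mul_comm]
    have h2 := kelvin_le_mul (b := b) hτ hτT hM (hτR.trans hy)
    rw [e2] at h2
    rw [div_le_iff₀ hε] at h1
    have h3 : τ ^ b / (‖y‖ ^ b) ^ 2 * M ≤ ε * (‖y‖ ^ b)⁻¹ := by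
      rw [div_mul_eq_mul_div, div_le_iff₀ (by positivity)]
      have : ε * (‖y‖ ^ b)⁻¹ * (‖y‖ ^ b) ^ 2 = ‖y‖ ^ b * ε := by field_simp
      rw [this]
      exact h1
    have := hu.pos y
    simp only [Pi.sub_apply, e1]
    linarith
  · intro y hy hneg
    have hlt : R < ‖y‖ ^ 2 := by
      refine lt_of_le_of_ne hy fun heq => ?_
      have := hbd y heq.symm
      simp only [Pi.sub_apply] at hneg
      linarith
    refine ⟨mem_of_superset ((isOpen_lt continuous_const hns).mem_nhds hlt)
      fun z (hz : R < ‖z‖ ^ 2) => hz.le, hw y hy, hh y hy, ?_⟩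
    refine (hu.laplacian_sub_kelvin_le hb0 hb hτ hτT hM (hτR.trans hy) hneg).trans_lt ?_
    have hlap := laplacian_norm_sq_rpow (-b / 2) (hne y hy)
    simp only [sub_zero] at hlap
    have hρ := hpos y hy
    rw [hlap, ← hb, rpow_sub_one hρ.ne']
    have hq : 0 < (‖y‖ ^ 2) ^ (-b / 2) := rpow_pos_of_pos hρ _
    have e1 : (u - kelvin b τ u) y / (‖y‖ ^ 2) ^ (-b / 2) *
        (4 * (-b / 2) * (-b / 2 + (2 * b + 2) / 2 - 1) * ((‖y‖ ^ 2) ^ (-b / 2) / ‖y‖ ^ 2)) =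
        b ^ 2 / ‖y‖ ^ 2 * -(u - kelvin b τ u) y := by
      field_simp
      ring
    rw [e1]
    refine mul_lt_mul_of_pos_right ?_ (by linarith)
    have e2 : (1 + 2 / b) * M ^ (2 / b) * (τ / ‖y‖ ^ 2) ^ 2 =
        ((1 + 2 / b) * M ^ (2 / b) * τ ^ 2 / ‖y‖ ^ 2) / ‖y‖ ^ 2 := by
      field_simp
    rw [e2]
    refine div_lt_div_of_pos_right ?_ hρ
    rw [div_lt_iff₀ hρ]
    nlinarith [sq_nonneg b]

lemma kelvin_le_of_narrow (hu : IsCriticalSolution b u) (hb0 : 0 < b)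
    (hb : 2 * b + 2 = finrank ℝ E) {τ T M R : ℝ} (hτ : 0 < τ) (hτT : τ ≤ T)
    (hM : ∀ z : E, ‖z‖ ^ 2 ≤ T → u z ≤ M) (hτR : τ < R)
    (hR : (1 + 2 / b) * M ^ (2 / b) * (2 * (R - τ)) < 4 * b + 4)
    (hbd : ∀ y : E, ‖y‖ ^ 2 = R → kelvin b τ u y ≤ u y) :
    ∀ y : E, τ ≤ ‖y‖ ^ 2 → ‖y‖ ^ 2 ≤ R → kelvin b τ u y ≤ u y := by
  set S : Set E := {y | τ ≤ ‖y‖ ^ 2 ∧ ‖y‖ ^ 2 ≤ R} with hS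
  have hns : Continuous fun y : E => ‖y‖ ^ 2 := by fun_prop
  have hpos : ∀ y ∈ S, 0 < ‖y‖ ^ 2 := fun y hy => hτ.trans_le hy.1
  have hne : ∀ y ∈ S, y ≠ 0 := by
    rintro y hy rfl
    simpa using hpos _ hy
  have hM0 : 0 < M := (hu.pos 0).trans_le (hM 0 (by simp; linarith))
  have hnsc : ContDiff ℝ 2 fun y : E => ‖y‖ ^ 2 := contDiff_norm_sq ℝ
  have hh : ContDiff ℝ 2 ((fun _ : E => 2 * R - τ) - fun y : E => ‖y‖ ^ 2) :=
    contDiff_const.sub hnsc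
  have hw : ∀ y ∈ S, ContDiffAt ℝ 2 (u - kelvin b τ u) y := fun y hy =>
    hu.contDiffAt_sub_kelvin hτ (hne y hy)
  have hhpos : ∀ y ∈ S, 0 < ((fun _ : E => 2 * R - τ) - fun y : E => ‖y‖ ^ 2) y := fun y hy => by
    have := hy.2
    simp only [Pi.sub_apply]
    linarith
  have hSc : IsClosed S :=
    (isClosed_le continuous_const hns).inter (isClosed_le hns continuous_const)
  have key := nonneg_of_laplacian_lt hSc
    (fun y hy => (hw y hy).continuousAt.continuousWithinAt) hh.continuous.continuousOn
    hhpos (fun ε _ => ⟨R + 1, fun y hy hyR => ?_⟩) ?_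
  · intro y hy1 hy2
    have := key y ⟨hy1, hy2⟩
    simpa using this
  · have := hy.2
    nlinarith
  · intro y hy hneg
    have hneg' := hneg
    simp only [Pi.sub_apply] at hneg'
    have hlt1 : τ < ‖y‖ ^ 2 := by
      refine lt_of_le_of_ne hy.1 fun heq => ?_
      have := kelvin_of_norm_sq_eq b hτ u heq.symm
      linarith
    have hlt2 : ‖y‖ ^ 2 < R := by
      refine lt_of_le_of_ne hy.2 fun heq => ?_
      have := hbd y heq
      linarith
    have ho : IsOpen {y : E | τ < ‖y‖ ^ 2 ∧ ‖y‖ ^ 2 < R} :=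
      (isOpen_lt continuous_const hns).inter (isOpen_lt hns continuous_const)
    refine ⟨mem_of_superset (ho.mem_nhds ⟨hlt1, hlt2⟩) fun z hz => ⟨hz.1.le, hz.2.le⟩,
      hw y hy, hh.contDiffAt, ?_⟩
    refine (hu.laplacian_sub_kelvin_le hb0 hb hτ hτT hM hy.1 hneg).trans_lt ?_
    have hρ := hpos y hy
    have hlap := laplacian_norm_sq_rpow 1 (hne y hy)
    simp only [sub_zero, rpow_one] at hlap
    have hcst : Δ (fun _ : E => 2 * R - τ) y = 0 := by simp
    have hle : ((fun _ : E => 2 * R - τ) - fun y : E => ‖y‖ ^ 2) y ≤ 2 * (R - τ) := by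
      simp only [Pi.sub_apply]
      linarith
    have hh0 := hhpos y hy
    rw [contDiffAt_const.laplacian_sub hnsc.contDiffAt, hcst, hlap, ← hb, sub_self, rpow_zero]
    generalize ((fun _ : E => 2 * R - τ) - fun y : E => ‖y‖ ^ 2) y = h at hle hh0
    have e1 : (u - kelvin b τ u) y / h * (0 - 4 * 1 * (1 + (2 * b + 2) / 2 - 1) * 1) =
        (4 * b + 4) / h * -(u - kelvin b τ u) y := by
      field_simp
      ring
    rw [e1]
    refine mul_lt_mul_of_pos_right ?_ (by linarith)
    rw [lt_div_iff₀ hh0]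
    have h1 : (τ / ‖y‖ ^ 2) ^ 2 ≤ 1 :=
      pow_le_one₀ (by positivity) ((div_le_one hρ).2 hy.1)
    calc _ ≤ (1 + 2 / b) * M ^ (2 / b) * 1 * (2 * (R - τ)) := by gcongr
      _ < _ := by rwa [mul_one]

lemma exists_norm_sq_bound (hu : Continuous u) (T : ℝ) : ∃ M, ∀ z : E, ‖z‖ ^ 2 ≤ T → u z ≤ M := by
  obtain ⟨M, hM⟩ := (isCompact_closedBall (0 : E) √T).bddAbove_image hu.continuousOn
  refine ⟨M, fun z hz => hM ⟨z, ?_, rfl⟩⟩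
  rw [mem_closedBall_zero_iff]
  exact Real.le_sqrt_of_sq_le hz

lemma exists_kelvin_le_of_lt (hu : IsCriticalSolution b u) (hb0 : 0 < b)
    (hb : 2 * b + 2 = finrank ℝ E) :
    ∃ ε > 0, ∀ τ, 0 < τ → τ < ε → ∀ y : E, τ ≤ ‖y‖ ^ 2 → kelvin b τ u y ≤ u y := by
  obtain ⟨M, hM⟩ := exists_norm_sq_bound hu.contDiff.continuous 1
  have hM0 : 0 < M := (hu.pos 0).trans_le (hM 0 (by simp))
  have hC : 0 < (1 + 2 / b) * M ^ (2 / b) := by positivity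
  refine ⟨min 1 (b ^ 2 / ((1 + 2 / b) * M ^ (2 / b))), by positivity, fun τ hτ hτε => ?_⟩
  obtain ⟨h1, h2⟩ := lt_min_iff.1 hτε
  rw [lt_div_iff₀ hC] at h2
  refine hu.kelvin_le_of_large hb0 hb hτ h1.le hM le_rfl ?_ fun y hy =>
    (kelvin_of_norm_sq_eq b hτ u hy).le
  nlinarith

lemma kelvin_le_of_forall_lt (hu : IsCriticalSolution b u) {σ : ℝ} (hσ : 0 < σ)
    (h : ∀ τ, 0 < τ → τ < σ → ∀ y : E, τ ≤ ‖y‖ ^ 2 → kelvin b τ u y ≤ u y) :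
    ∀ y : E, σ ≤ ‖y‖ ^ 2 → kelvin b σ u y ≤ u y := by
  intro y hy
  have hy0 : y ≠ 0 := by rintro rfl; simp at hy; linarith
  have hc : ContinuousAt (fun τ => kelvin b τ u y) σ :=
    ContinuousAt.comp (g := fun q : ℝ × E => kelvin b q.1 u q.2) (f := fun τ => (τ, y))
      (continuousAt_kelvin b hu.contDiff.continuous hσ hy0) (by fun_prop)
  refine le_of_tendsto (hc.tendsto.mono_left nhdsWithin_le_nhds : Tendsto _ (𝓝[<] σ) _) ?_
  filter_upwards [Ioo_mem_nhdsLT hσ] with τ hτ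
  exact h τ hτ.1 hτ.2 y (hτ.2.le.trans hy)

lemma exists_kelvin_le_of_pos (hu : IsCriticalSolution b u) (hb0 : 0 < b)
    (hb : 2 * b + 2 = finrank ℝ E) {σ : ℝ} (hσ : 0 < σ)
    (h : ∀ y : E, σ < ‖y‖ ^ 2 → kelvin b σ u y < u y) :
    ∃ ε > 0, ∀ τ, σ ≤ τ → τ < σ + ε → ∀ y : E, τ ≤ ‖y‖ ^ 2 → kelvin b τ u y ≤ u y := by
  obtain ⟨M, hM⟩ := exists_norm_sq_bound hu.contDiff.continuous (σ + 1)
  have hM0 : 0 < M := (hu.pos 0).trans_le (hM 0 (by simp; linarith))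
  have hC : 0 < (1 + 2 / b) * M ^ (2 / b) := by positivity
  set C := (1 + 2 / b) * M ^ (2 / b)
  obtain ⟨δ, hδ0, hδ⟩ : ∃ δ > 0, C * (2 * δ) < 4 * b + 4 :=
    ⟨1 / C, by positivity, by field_simp; linarith⟩
  obtain ⟨R, hRδ, hR⟩ : ∃ R, σ + δ < R ∧ C * (σ + 1) ^ 2 < b ^ 2 * R := by
    refine ⟨max (σ + δ) (C * (σ + 1) ^ 2 / b ^ 2) + 1,
      lt_add_of_le_of_pos (le_max_left _ _) one_pos, ?_⟩
    have := le_max_right (σ + δ) (C * (σ + 1) ^ 2 / b ^ 2)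
    rw [← div_lt_iff₀' (by positivity)]
    linarith
  have hns : Continuous fun y : E => ‖y‖ ^ 2 := by fun_prop
  have hK : IsCompact {y : E | σ + δ ≤ ‖y‖ ^ 2 ∧ ‖y‖ ^ 2 ≤ R} := by
    have hcl : IsClosed {y : E | σ + δ ≤ ‖y‖ ^ 2 ∧ ‖y‖ ^ 2 ≤ R} :=
      (isClosed_le continuous_const hns).inter (isClosed_le hns continuous_const)
    refine (isCompact_closedBall (0 : E) √R).of_isClosed_subset hcl fun y hy => ?_
    rw [mem_closedBall_zero_iff]
    exact Real.le_sqrt_of_sq_le hy.2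
  have hev : ∀ᶠ τ in 𝓝 σ, ∀ y ∈ {y : E | σ + δ ≤ ‖y‖ ^ 2 ∧ ‖y‖ ^ 2 ≤ R},
      kelvin b τ u y < u y := by
    refine hK.eventually_forall_of_forall_eventually fun y hy => ?_
    have hy0 : y ≠ 0 := by rintro rfl; have := hy.1; simp at this; linarith
    exact (continuousAt_kelvin b hu.contDiff.continuous hσ hy0).eventually_lt
      (hu.contDiff.continuous.continuousAt.comp (f := fun q : ℝ × E => q.2) continuousAt_snd)
      (h y (by linarith [hy.1]))
  obtain ⟨ε, hε0, hε⟩ := Metric.eventually_nhds_iff.1 hev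
  refine ⟨min ε (min 1 δ), by positivity, fun τ hστ hτ y hy => ?_⟩
  have hτ1 : τ < σ + ε := hτ.trans_le (by gcongr; exact min_le_left _ _)
  have hτ2 : τ < σ + 1 := hτ.trans_le (by gcongr; exact (min_le_right _ _).trans (min_le_left _ _))
  have hτ3 : τ < σ + δ := hτ.trans_le (by gcongr; exact (min_le_right _ _).trans (min_le_right _ _))
  have hτ0 : 0 < τ := hσ.trans_le hστ
  have hmid := hε (y := τ) (by rw [Real.dist_eq, abs_of_nonneg] <;> linarith)
  rcases le_total (‖y‖ ^ 2) (σ + δ) with h1 | h1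
  · refine hu.kelvin_le_of_narrow hb0 hb hτ0 hτ2.le hM hτ3 ?_
      (fun z hz => (hmid z ⟨hz.ge, hz.le.trans hRδ.le⟩).le) y hy h1
    refine lt_of_le_of_lt ?_ hδ
    gcongr
    linarith
  rcases le_total (‖y‖ ^ 2) R with h2 | h2
  · exact (hmid y ⟨h1, h2⟩).le
  · refine hu.kelvin_le_of_large hb0 hb hτ0 hτ2.le hM (by linarith) ?_
      (fun z hz => (hmid z ⟨hRδ.le.trans hz.ge, hz.le⟩).le) y h2
    refine lt_of_le_of_lt ?_ hR
    gcongr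

/-- Either all spheres can be moved, or `u` is invariant under one of the Kelvin transforms. -/
lemma kelvin_le_or_exists_kelvin_eq (hu : IsCriticalSolution b u) (hb0 : 0 < b)
    (hb : 2 * b + 2 = finrank ℝ E) :
    (∀ τ, 0 < τ → ∀ y : E, τ ≤ ‖y‖ ^ 2 → kelvin b τ u y ≤ u y) ∨
      ∃ τ > 0, ∀ y : E, y ≠ 0 → kelvin b τ u y = u y := by
  have hE : 1 < finrank ℝ E := by
    have : (1 : ℝ) < finrank ℝ E := by rw [← hb]; linarith
    exact_mod_cast this
  have : Nontrivial E := nontrivial_of_finrank_pos (R := ℝ) (by omega)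
  by_contra! hcon
  obtain ⟨⟨τ₁, hτ₁, y₁, hy₁, hlt₁⟩, hne⟩ := hcon
  set S : Set ℝ := {τ | 0 < τ ∧ ∃ y : E, τ ≤ ‖y‖ ^ 2 ∧ u y < kelvin b τ u y} with hS
  have hSne : S.Nonempty := ⟨τ₁, hτ₁, y₁, hy₁, hlt₁⟩
  have hbdd : BddBelow S := ⟨0, fun τ hτ => hτ.1.le⟩
  obtain ⟨ε, hε, hsmall⟩ := hu.exists_kelvin_le_of_lt hb0 hb
  have hσ : 0 < sInf S := hε.trans_le <| le_csInf hSne fun τ ⟨hτ, y, hy, hlt⟩ => by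
    by_contra! hτε
    exact (hsmall τ hτ hτε y hy).not_gt hlt
  have hbelow : ∀ τ, 0 < τ → τ < sInf S → ∀ y : E, τ ≤ ‖y‖ ^ 2 → kelvin b τ u y ≤ u y := by
    intro τ hτ hτσ y hy
    by_contra! hlt
    exact notMem_of_lt_csInf hτσ hbdd ⟨hτ, y, hy, hlt⟩
  have hle := hu.kelvin_le_of_forall_lt hσ hbelow
  have hns : Continuous fun y : E => ‖y‖ ^ 2 := by fun_prop
  have hne0 : ∀ y ∈ {y : E | sInf S < ‖y‖ ^ 2}, y ≠ 0 := by
    rintro y hy rfl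
    have : sInf S < ‖(0 : E)‖ ^ 2 := hy
    simp at this
    linarith
  rcases eqOn_zero_or_pos_of_laplacian_nonpos (isOpen_lt continuous_const hns)
    (isPreconnected_setOf_lt_norm_sq hE hσ)
    (fun y hy => hu.contDiffAt_sub_kelvin (b := b) hσ (hne0 y hy))
    (fun y (hy : sInf S < ‖y‖ ^ 2) => sub_nonneg.2 (hle y hy.le))
    (fun y hy => by
      rw [hu.laplacian_sub_kelvin hb0 hb hσ (hne0 y hy), sub_nonpos]
      exact rpow_le_rpow (kelvin_pos b hσ hu.pos (hne0 y hy)).le (hle y (le_of_lt hy))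
        (by positivity)) with h | h
  · obtain ⟨y, hy0, hy⟩ := hne _ hσ
    refine hy (kelvin_eq_of_forall_le hσ (fun z hz => ?_) hy0)
    rcases hz.eq_or_lt with heq | hlt
    · exact kelvin_of_norm_sq_eq b hσ u heq.symm
    · exact (sub_eq_zero.1 (h z hlt)).symm
  · obtain ⟨ε', hε', hgood⟩ := hu.exists_kelvin_le_of_pos hb0 hb hσ
      fun y hy => sub_pos.1 (h y hy)
    obtain ⟨τ, ⟨hτ, y, hy, hlt⟩, hτσ⟩ := exists_lt_of_csInf_lt hSne (lt_add_of_pos_right _ hε')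
    exact (hgood τ (csInf_le hbdd ⟨hτ, y, hy, hlt⟩) hτσ y hy).not_gt hlt

lemma not_kelvin_le_of_kelvin_eq [Nontrivial E] (hu : IsCriticalSolution b u) (hb0 : 0 < b)
    {c₀ c : E} {τ₀ : ℝ} (hτ₀ : 0 < τ₀)
    (heq : ∀ y : E, y ≠ 0 → kelvin b τ₀ (fun z => u (z + c₀)) y = u (y + c₀)) :
    ¬∀ τ, 0 < τ → ∀ y : E, τ ≤ ‖y‖ ^ 2 → kelvin b τ (fun z => u (z + c)) y ≤ u (y + c) := by
  intro hle
  obtain ⟨M, hM⟩ := exists_norm_sq_bound (hu.comp_add_right c₀).contDiff.continuous (τ₀ ^ 2)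
  have hM0 : 0 < M := (hu.pos _).trans_le (hM 0 (by simp; positivity))
  obtain ⟨m, hm0, hm⟩ : ∃ m > 0, ∀ z : E, ‖z‖ ≤ 1 → m ≤ u (z + c) := by
    obtain ⟨z, -, hz⟩ := (isCompact_closedBall (0 : E) 1).exists_isMinOn
      (Metric.nonempty_closedBall.2 zero_le_one)
      (hu.comp_add_right c).contDiff.continuous.continuousOn
    exact ⟨_, hu.pos _, fun w hw => hz (mem_closedBall_zero_iff.2 hw)⟩
  obtain ⟨r, hr, hr0⟩ := (((tendsto_rpow_atTop hb0).eventually_gt_atTop (M / m)).and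
    (eventually_gt_atTop 0)).exists
  set τ := r * (4 * τ₀) with hτdef
  have hτ : 0 < τ := by positivity
  obtain ⟨y, hy⟩ := NormedSpace.exists_lt_norm ℝ E (τ + 1 + 2 + 2 * ‖c - c₀‖)
  have hn := norm_nonneg (c - c₀)
  have hyτ : τ ≤ ‖y‖ := by linarith
  have hy2 : 2 ≤ ‖y‖ := by linarith
  have hy0 : 0 < ‖y‖ := by linarith
  have hyne : y ≠ 0 := norm_pos_iff.1 hy0
  have hz : ‖y‖ / 2 ≤ ‖y + (c - c₀)‖ := by
    have := norm_sub_le (y + (c - c₀)) (c - c₀)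
    rw [add_sub_cancel_right] at this
    linarith
  have hz0 : 0 < ‖y + (c - c₀)‖ := by linarith
  have hz2 : ‖y‖ ^ 2 / 4 ≤ ‖y + (c - c₀)‖ ^ 2 := by nlinarith
  have h1 := hle τ hτ y (by nlinarith)
  have h2 : (τ / ‖y‖ ^ 2) ^ b * m ≤ u (y + c) := by
    refine le_trans ?_ h1
    refine mul_le_mul_of_nonneg_left (hm _ ?_) (by positivity)
    rw [norm_smul, Real.norm_of_nonneg (by positivity), sq, ← div_div, div_mul_cancel₀ _ hy0.ne',
      div_le_one hy0]
    exact hyτ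
  have h3 : u (y + c) ≤ (τ₀ / ‖y + (c - c₀)‖ ^ 2) ^ b * M := by
    have h := heq (y + (c - c₀)) (norm_pos_iff.1 hz0)
    rw [add_assoc, sub_add_cancel] at h
    rw [← h]
    refine mul_le_mul_of_nonneg_left (hM _ ?_) (by positivity)
    rw [norm_sq_inversion (norm_pos_iff.1 hz0)]
    exact div_le_self (by positivity) (by nlinarith)
  have h4 : (τ₀ / ‖y + (c - c₀)‖ ^ 2) ^ b ≤ (4 * τ₀ / ‖y‖ ^ 2) ^ b := by
    refine rpow_le_rpow (by positivity) ?_ hb0.le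
    rw [div_le_div_iff₀ (by positivity) (by positivity)]
    nlinarith
  have h5 : (τ / ‖y‖ ^ 2) ^ b = r ^ b * (4 * τ₀ / ‖y‖ ^ 2) ^ b := by
    rw [← mul_rpow hr0.le (by positivity), hτdef, mul_div_assoc]
  have hP : 0 < (4 * τ₀ / ‖y‖ ^ 2) ^ b := by positivity
  rw [div_lt_iff₀ hm0] at hr
  have h6 : (4 * τ₀ / ‖y‖ ^ 2) ^ b * (r ^ b * m) ≤ (4 * τ₀ / ‖y‖ ^ 2) ^ b * M := by
    calc _ = (τ / ‖y‖ ^ 2) ^ b * m := by rw [h5]; ring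
      _ ≤ _ := h2.trans (h3.trans (by gcongr))
  exact (le_of_mul_le_mul_left h6 hP).not_gt hr

lemma exists_kelvin_eq (hu : IsCriticalSolution b u) (hb0 : 0 < b)
    (hb : 2 * b + 2 = finrank ℝ E) (x : E) :
    ∃ τ > 0, ∀ y : E, y ≠ 0 → kelvin b τ (fun z => u (z + x)) y = u (y + x) := by
  have hE : 0 < finrank ℝ E := by
    have : (0 : ℝ) < finrank ℝ E := by rw [← hb]; linarith
    exact_mod_cast this
  have : Nontrivial E := nontrivial_of_finrank_pos hE
  have hdich c := (hu.comp_add_right c).kelvin_le_or_exists_kelvin_eq hb0 hb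
  refine (hdich x).resolve_left fun hx => ?_
  have hall : ∀ c : E, ∀ τ, 0 < τ → ∀ y : E, τ ≤ ‖y‖ ^ 2 →
      kelvin b τ (fun z => u (z + c)) y ≤ u (y + c) := fun c =>
    (hdich c).resolve_right fun ⟨_, hτ, heq⟩ => hu.not_kelvin_le_of_kelvin_eq hb0 hτ heq hx
  have hconst : u = fun _ => u 0 := funext fun y =>
    (le_of_forall_kelvin_le hall 0 y).antisymm (le_of_forall_kelvin_le hall y 0)
  have h1 := hu.laplacian_eq 0
  have h2 : Δ u 0 = 0 := by rw [hconst]; simp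
  have := rpow_pos_of_pos (hu.pos 0) (1 + 2 / b)
  linarith

end IsCriticalSolution

lemma IsCriticalSolution.exists_eq {b : ℝ} {u : E → ℝ} (hu : IsCriticalSolution b u)
    (hb0 : 0 < b) (hb : 2 * b + 2 = finrank ℝ E) (h0 : u 0 = 1) (h0' : fderiv ℝ u 0 = 0) :
    ∃ γ > (0 : ℝ), ∀ x, u x = (1 + γ * ‖x‖ ^ 2) ^ (-b) := by
  have hE : 0 < finrank ℝ E := by
    have : (0 : ℝ) < finrank ℝ E := by rw [← hb]; linarith
    exact_mod_cast this
  have : Nontrivial E := nontrivial_of_finrank_pos hE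
  obtain ⟨τ₀, hτ₀, heq₀⟩ := hu.exists_kelvin_eq hb0 hb 0
  simp only [add_zero] at heq₀
  have hdiff : Differentiable ℝ u := hu.contDiff.differentiable (by norm_num)
  have hderiv : ∀ x e : E, fderiv ℝ u x e = -(2 * b * ⟪e, x⟫_ℝ * u x * u x ^ (1 / b) / τ₀) := by
    intro x e
    rcases eq_or_ne e 0 with rfl | he
    · simp
    obtain ⟨τ, hτ, heq⟩ := hu.exists_kelvin_eq hb0 hb x
    obtain ⟨h1, h2⟩ := rpow_mul_eq_and_fderiv_eq hτ hτ₀ hdiff he heq heq₀ h0'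
    have h3 : τ * u x ^ (1 / b) = τ₀ := by
      have := congrArg (· ^ (1 / b)) h1
      simp only [h0, mul_one] at this
      rwa [mul_rpow (by positivity) (hu.pos x).le, ← rpow_mul hτ.le, ← rpow_mul hτ₀.le,
        mul_one_div_cancel hb0.ne', rpow_one, rpow_one] at this
    have hux := rpow_pos_of_pos (hu.pos x) (1 / b)
    rw [← h3]
    field_simp
    linarith
  have hG : ∀ x, HasFDerivAt (fun y => u y ^ (-(1 / b)) - τ₀⁻¹ * ‖y‖ ^ 2) (0 : E →L[ℝ] ℝ) x := by
    intro x
    have h1 := (hdiff x).hasFDerivAt.rpow_const (p := -(1 / b)) (Or.inl (hu.pos x).ne')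
    have h2 := (hasStrictFDerivAt_norm_sq x).hasFDerivAt.const_mul τ₀⁻¹
    refine (h1.sub h2).congr_fderiv ?_
    ext e
    have hux := rpow_pos_of_pos (hu.pos x) (1 / b)
    have hx := hu.pos x
    simp only [_root_.sub_apply, _root_.smul_apply, hderiv, innerSL_apply_apply, smul_eq_mul,
      _root_.zero_apply, nsmul_eq_mul, Nat.cast_ofNat]
    rw [real_inner_comm, rpow_sub_one hx.ne', rpow_neg hx.le]
    field_simp
    ring
  have hconst : ∀ x, u x ^ (-(1 / b)) = 1 + τ₀⁻¹ * ‖x‖ ^ 2 := by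
    intro x
    have := is_const_of_fderiv_eq_zero (fun y => (hG y).differentiableAt)
      (fun y => (hG y).fderiv) x 0
    simp only [h0, norm_zero, one_rpow] at this
    linarith
  refine ⟨τ₀⁻¹, by positivity, fun x => ?_⟩
  rw [← hconst, ← rpow_mul (hu.pos x).le, neg_mul_neg, one_div_mul_cancel hb0.ne', rpow_one]

end MovingSpheres

/- STATEMENT 7 (Caffarelli–Gidas–Spruck classification): for `n ≥ 3`, any positive
`C²` solution of `-Δu = u^{(n+2)/(n-2)}` on ℝⁿ with `u(0) = 1`, `∇u(0) = 0` is of the form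
`u(x) = (1 + γ|x|²)^{(2-n)/2}` for some `γ > 0`. -/
theorem stmt7 (n : ℕ) (hn : 3 ≤ n) (u : EuclideanSpace ℝ (Fin n) → ℝ)
    (hu : ContDiff ℝ 2 u) (hpos : ∀ x, 0 < u x)
    (heq : ∀ x, -lap u x = u x ^ (((n : ℝ) + 2) / ((n : ℝ) - 2)))
    (h0 : u 0 = 1) (h0' : fderiv ℝ u 0 = 0) :
    ∃ γ > (0 : ℝ), ∀ x, u x = (1 + γ * ‖x‖ ^ 2) ^ ((2 - (n : ℝ)) / 2) := by
  set b : ℝ := ((n : ℝ) - 2) / 2 with hb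
  have hn' : (3 : ℝ) ≤ n := by exact_mod_cast hn
  have hb0 : 0 < b := by rw [hb]; linarith
  have hexp : ((n : ℝ) + 2) / ((n : ℝ) - 2) = 1 + 2 / b := by
    have : (n : ℝ) - 2 ≠ 0 := by linarith
    rw [hb]
    field_simp
    ring
  have hlap : ∀ x, lap u x = Δ u x := fun x => by
    simp [laplacian_eq_iteratedFDeriv_orthonormalBasis u (EuclideanSpace.basisFun (Fin n) ℝ), lap]
  have hsol : IsCriticalSolution b u := ⟨hu, hpos, fun x => by
    rw [← hlap, ← hexp, ← heq, neg_neg]⟩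
  obtain ⟨γ, hγ, h⟩ := hsol.exists_eq hb0 (by rw [finrank_euclideanSpace_fin, hb]; ring) h0 h0'
  refine ⟨γ, hγ, fun x => ?_⟩
  rw [h, show (2 - (n : ℝ)) / 2 = -b by rw [hb]; ring]
end
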